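/- arXiv:2301.06131 — 2 statements merged into one kernel-verified Lean document; each statement's English description precedes it below -/
import Mathlib

section
/- Blaschke–Santaló–Petty inequality: for every convex body K in ℝⁿ, the volume product satisfies P(K) ≤ P(B₂ⁿ) = vol(B₂ⁿ)², with equality if and only if K is an ellipsoid (i.e., the image of the Euclidean unit ball B₂ⁿ under an invertible affine map). -/
open MeasureTheory
open scoped InnerProductSpace Pointwise NNReal ENNReal

noncomputable section

/-- The polar of a set `K` in Euclidean space: `{y | ⟨x,y⟩ ≤ 1 for all x ∈ K}`. -/
def polarSet {n : ℕ} (K : Set (EuclideanSpace ℝ (Fin n))) : Set (EuclideanSpace ℝ (Fin n)) :=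
  {y | ∀ x ∈ K, ⟪x, y⟫_ℝ ≤ 1}

/-- A convex body: a compact convex set with nonempty interior. -/
structure IsConvexBody {n : ℕ} (K : Set (EuclideanSpace ℝ (Fin n))) : Prop where
  convex : Convex ℝ K
  isCompact : IsCompact K
  nonempty_interior : (interior K).Nonempty

/-- The volume product `P(K) = vol K * min_{z ∈ int K} vol ((K - z)*)`. -/
def volumeProduct {n : ℕ} (K : Set (EuclideanSpace ℝ (Fin n))) : ℝ≥0∞ :=
  volume K * ⨅ z : interior K, volume (polarSet ((fun x => x - (z : EuclideanSpace ℝ (Fin n))) '' K))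

open Set Filter Topology

/-! ### The one-dimensional inequality on the half-line -/

lemma hasDerivAt_primitive {f : ℝ → ℝ} (hf : Continuous f) (s : ℝ) :
    HasDerivAt (fun u => ∫ x in (0 : ℝ)..u, f x) (f s) s :=
  intervalIntegral.integral_hasDerivAt_right (hf.intervalIntegrable _ _)
    hf.aestronglyMeasurable.stronglyMeasurableAtFilter hf.continuousAt

lemma strictMono_primitive {f : ℝ → ℝ} (hf : Continuous f) (hpos : ∀ x, 0 < f x) :
    StrictMono (fun u => ∫ x in (0 : ℝ)..u, f x) :=
  strictMono_of_deriv_pos fun x => by rw [(hasDerivAt_primitive hf x).deriv]; exact hpos x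

lemma primitive_lt_integral_Ioi {f : ℝ → ℝ} (hf : Continuous f) (hpos : ∀ x, 0 < f x)
    (hi : IntegrableOn f (Ioi 0)) (s : ℝ) :
    ∫ x in (0 : ℝ)..s, f x < ∫ x in Ioi 0, f x := by
  have hm := strictMono_primitive hf hpos
  have ht := intervalIntegral_tendsto_integral_Ioi 0 hi tendsto_id
  exact (hm (lt_add_one s)).trans_le (hm.monotone.ge_of_tendsto ht (s + 1))

lemma exists_primitive_eq {f : ℝ → ℝ} (hf : Continuous f)
    (hi : IntegrableOn f (Ioi 0)) {v : ℝ} (hv : 0 < v) (hv' : v < ∫ x in Ioi 0, f x) :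
    ∃ s > 0, ∫ x in (0 : ℝ)..s, f x = v := by
  have ht := intervalIntegral_tendsto_integral_Ioi 0 hi tendsto_id
  obtain ⟨b, hb, hb0⟩ := ((ht.eventually (lt_mem_nhds hv')).and (eventually_gt_atTop 0)).exists
  have hc : Continuous (fun u => ∫ x in (0 : ℝ)..u, f x) :=
    continuous_iff_continuousAt.2 fun x => (hasDerivAt_primitive hf x).continuousAt
  obtain ⟨s, hs, hsv⟩ := intermediate_value_Ioo hb0.le hc.continuousOn
    (show v ∈ Ioo _ _ from ⟨by simpa using hv, hb⟩)
  exact ⟨s, hs.1, hsv⟩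

/-- Monotone transport between two continuous positive densities on the half-line. -/
lemma exists_transport {f g : ℝ → ℝ} (hf : Continuous f) (hg : Continuous g)
    (hfpos : ∀ x, 0 < f x) (hgpos : ∀ x, 0 < g x)
    (hfi : IntegrableOn f (Ioi 0)) (hgi : IntegrableOn g (Ioi 0)) :
    ∃ T : ℝ → ℝ, ∀ s > 0, 0 < T s ∧
      HasDerivAt T (f s * (∫ x in Ioi 0, g x) / ((∫ x in Ioi 0, f x) * g (T s))) s := by
  set A := ∫ x in Ioi 0, f x
  set B := ∫ x in Ioi 0, g x
  set F := fun u => ∫ x in (0 : ℝ)..u, f x with hF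
  set G := fun u => ∫ x in (0 : ℝ)..u, g x with hG
  have hFm : StrictMono F := strictMono_primitive hf hfpos
  have hGm : StrictMono G := strictMono_primitive hg hgpos
  have hF0 : F 0 = 0 := by simp [hF]
  have hG0 : G 0 = 0 := by simp [hG]
  have hA : 0 < A := by simpa using primitive_lt_integral_Ioi hf hfpos hfi 0
  have hB : 0 < B := by simpa using primitive_lt_integral_Ioi hg hgpos hgi 0
  have hex : ∀ s : ℝ, ∃ t, 0 < s → 0 < t ∧ G t = B / A * F s := by
    intro s
    by_cases hs : 0 < s
    · have h1 : 0 < F s := hF0 ▸ hFm hs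
      have h2 : F s < A := primitive_lt_integral_Ioi hf hfpos hfi s
      obtain ⟨t, ht, hGt⟩ := exists_primitive_eq hg hgi (v := B / A * F s) (by positivity) (by
        change _ < B
        rw [div_mul_eq_mul_div, div_lt_iff₀ hA]
        exact mul_lt_mul_of_pos_left h2 hB)
      exact ⟨t, fun _ => ⟨ht, hGt⟩⟩
    · exact ⟨0, fun h => absurd h hs⟩
  choose T hT using hex
  have hTmono : MonotoneOn T (Ioi 0) := by
    intro a ha b hb hab
    rw [← hGm.le_iff_le, (hT a ha).2, (hT b hb).2]
    exact mul_le_mul_of_nonneg_left (hFm.monotone hab) (by positivity)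
  have hTim : T '' Ioi 0 = Ioi 0 := by
    ext t
    constructor
    · rintro ⟨s, hs, rfl⟩; exact (hT s hs).1
    · intro ht
      have h1 : 0 < G t := hG0 ▸ hGm ht
      have h2 : G t < B := primitive_lt_integral_Ioi hg hgpos hgi t
      obtain ⟨s, hs, hFs⟩ := exists_primitive_eq hf hfi (v := A / B * G t) (by positivity) (by
        change _ < A
        rw [div_mul_eq_mul_div, div_lt_iff₀ hB]
        exact mul_lt_mul_of_pos_left h2 hA)
      refine ⟨s, hs, hGm.injective ?_⟩
      rw [(hT s hs).2]
      change F s = _ at hFs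
      rw [hFs]
      field_simp
  refine ⟨T, fun s hs => ⟨(hT s hs).1, ?_⟩⟩
  have hc : ContinuousAt T s := continuousAt_of_monotoneOn_of_image_mem_nhds hTmono
    (Ioi_mem_nhds hs) (by rw [hTim]; exact Ioi_mem_nhds (hT s hs).1)
  have hd : HasDerivAt (fun t => A / B * G t) (A / B * g (T s)) (T s) :=
    (hasDerivAt_primitive hg (T s)).const_mul _
  have hd2 : HasDerivAt F (f s) s := hasDerivAt_primitive hf s
  -- invert `G` and compose with `F`
  have hne : A / B * g (T s) ≠ 0 := by have := hgpos (T s); positivity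
  have hloc : HasDerivAt (fun v => T v) (f s / (A / B * g (T s))) s := by
    rw [hasDerivAt_iff_tendsto_slope] at hd2 ⊢
    have h3 : Tendsto (fun v => slope F s v / slope (fun t => A / B * G t) (T s) (T v)) (𝓝[≠] s)
        (𝓝 (f s / (A / B * g (T s)))) := by
      refine hd2.div ?_ hne
      refine (hasDerivAt_iff_tendsto_slope.1 hd).comp ?_
      refine tendsto_nhdsWithin_iff.2 ⟨hc.tendsto.mono_left nhdsWithin_le_nhds, ?_⟩
      filter_upwards [self_mem_nhdsWithin, nhdsWithin_le_nhds (Ioi_mem_nhds hs)] with v hv hv0 h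
      have h4 : G (T v) = G (T s) := by rw [h]
      rw [(hT v hv0).2, (hT s hs).2] at h4
      exact hv (hFm.injective (mul_left_cancel₀ (by positivity) h4))
    refine h3.congr' ?_
    filter_upwards [self_mem_nhdsWithin, nhdsWithin_le_nhds (Ioi_mem_nhds hs)] with v hv hv0
    have e1 : A / B * G (T v) = F v := by rw [(hT v hv0).2]; field_simp
    have e2 : A / B * G (T s) = F s := by rw [(hT s hs).2]; field_simp
    have hFne : F v - F s ≠ 0 := sub_ne_zero.2 fun h => hv (hFm.injective h)
    have hvs : v - s ≠ 0 := sub_ne_zero.2 hv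
    have hTne : T v - T s ≠ 0 := sub_ne_zero.2 fun h => hFne (by rw [← e1, ← e2, h, sub_self])
    simp only [slope_def_field]
    rw [e1, e2]
    field_simp
  convert hloc using 1
  field_simp

lemma integral_exp_neg_half_sq_Ioi :
    ∫ x in Ioi (0 : ℝ), Real.exp (-(x ^ 2 / 2)) = √(Real.pi / 2) := by
  have h := integral_gaussian_Ioi (1 / 2)
  have e : (fun x : ℝ => Real.exp (-(1 / 2) * x ^ 2)) = fun x => Real.exp (-(x ^ 2 / 2)) := by
    ext x; ring_nf
  rw [e] at h
  rw [h, show Real.pi / (1 / 2) = (Real.pi / 2) * 2 ^ 2 by ring,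
    Real.sqrt_mul (by positivity), Real.sqrt_sq (by norm_num)]
  ring

lemma integrableOn_exp_neg_half_sq :
    IntegrableOn (fun x : ℝ => Real.exp (-(x ^ 2 / 2))) (Ioi 0) := by
  have h := (integrable_exp_neg_mul_sq (b := 1 / 2) (by norm_num)).integrableOn (s := Ioi 0)
  refine h.congr_fun (fun x _ => ?_) measurableSet_Ioi
  simp only []
  ring_nf

/-- One-dimensional Santaló inequality on the half-line, with its equality case. -/
theorem half_line_santalo {f g : ℝ → ℝ} (hf : Continuous f) (hg : Continuous g)
    (hfpos : ∀ x, 0 < f x) (hgpos : ∀ x, 0 < g x)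
    (hfi : IntegrableOn f (Ioi 0)) (hgi : IntegrableOn g (Ioi 0)) {m : ℝ} (hm : 0 < m)
    (h : ∀ s > 0, ∀ t > 0, f s * g t ≤ m * Real.exp (-(s * t))) :
    (∫ s in Ioi 0, f s) * (∫ t in Ioi 0, g t) ≤ m * (Real.pi / 2) ∧
    ((∫ s in Ioi 0, f s) * (∫ t in Ioi 0, g t) = m * (Real.pi / 2) →
      ∃ l > 0, ∃ a > 0, ∀ s > 0, f s = a * Real.exp (-(l * s ^ 2 / 2)) ∧
        g s = m / a * Real.exp (-(s ^ 2 / (2 * l)))) := by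
  obtain ⟨T, hT⟩ := exists_transport hf hg hfpos hgpos hfi hgi
  have hA : 0 < ∫ x in Ioi 0, f x := by simpa using primitive_lt_integral_Ioi hf hfpos hfi 0
  have hB : 0 < ∫ x in Ioi 0, g x := by simpa using primitive_lt_integral_Ioi hg hgpos hgi 0
  have hFA := primitive_lt_integral_Ioi hf hfpos hfi
  have hFt := intervalIntegral_tendsto_integral_Ioi 0 hfi tendsto_id
  set A := ∫ x in Ioi 0, f x
  set B := ∫ x in Ioi 0, g x
  set T' := fun s => f s * B / (A * g (T s)) with hT'
  set w := fun s => √(s * T s) with hw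
  set w' := fun s => (T s + s * T' s) / (2 * w s) with hw'
  have hwpos : ∀ s > 0, 0 < w s := fun s hs => Real.sqrt_pos.2 (mul_pos hs (hT s hs).1)
  have hT'pos : ∀ s, 0 < T' s := fun s => by
    have := hfpos s; have := hgpos (T s); positivity
  have hwd : ∀ s > 0, HasDerivAt w (w' s) s := fun s hs => by
    have := ((hasDerivAt_id s).mul (hT s hs).2).sqrt (mul_pos hs (hT s hs).1).ne'
    refine this.congr_deriv ?_
    simp [hw', hw, hT']
  set E := fun u => ∫ x in (0 : ℝ)..u, Real.exp (-(x ^ 2 / 2)) with hE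
  have hEc : Continuous (fun x : ℝ => Real.exp (-(x ^ 2 / 2))) := by fun_prop
  have hElt : ∀ u, E u < √(Real.pi / 2) := fun u => by
    rw [← integral_exp_neg_half_sq_Ioi]
    exact primitive_lt_integral_Ioi hEc (fun x => Real.exp_pos _) integrableOn_exp_neg_half_sq u
  have hEnn : ∀ u ≥ 0, 0 ≤ E u := fun u hu => by
    have := (strictMono_primitive hEc (fun x => Real.exp_pos _)).monotone hu
    simpa [hE] using this
  set k := √(m * A / B) with hk
  have hkpos : 0 < k := Real.sqrt_pos.2 (by positivity)
  have hk2 : k ^ 2 = m * A / B := Real.sq_sqrt (by positivity)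
  set F := fun u => ∫ x in (0 : ℝ)..u, f x with hF
  set D := fun s => k * E (w s) - F s with hD
  have hDd : ∀ s > 0, HasDerivAt D (k * (Real.exp (-(w s ^ 2 / 2)) * w' s) - f s) s := fun s hs =>
    (((hasDerivAt_primitive hEc (w s)).comp s (hwd s hs)).const_mul k).sub
      (hasDerivAt_primitive hf s)
  have hw2 : ∀ s > 0, w s ^ 2 = s * T s := fun s hs => Real.sq_sqrt (mul_pos hs (hT s hs).1).le
  -- squared forms of the two pointwise inequalities
  have hw'sq : ∀ s > 0, w' s ^ 2 = T' s + (T s - s * T' s) ^ 2 / (4 * (s * T s)) := fun s hs => by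
    have h1 := (hT s hs).1
    have : w' s ^ 2 = (T s + s * T' s) ^ 2 / (4 * (s * T s)) := by
      rw [hw', div_pow, mul_pow, hw2 s hs]; norm_num
    rw [this]; field_simp; ring
  have hf2 : ∀ s > 0, f s ^ 2 = (f s * g (T s)) * (A / B) * T' s := fun s hs => by
    have := hgpos (T s)
    rw [hT']; field_simp
  have hfg : ∀ s > 0, f s * g (T s) ≤ m * Real.exp (-(w s ^ 2 / 2)) ^ 2 := fun s hs => by
    rw [← Real.exp_nat_mul, hw2 s hs]
    refine (h s hs _ (hT s hs).1).trans (le_of_eq ?_)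
    push_cast; ring_nf
  have hw'pos : ∀ s > 0, 0 < w' s := fun s hs => by
    have := (hT s hs).1; have := hT'pos s; have := hwpos s hs; positivity
  have hle : ∀ s > 0, f s ≤ k * (Real.exp (-(w s ^ 2 / 2)) * w' s) := fun s hs => by
    have h1 := hw'pos s hs
    refine (sq_le_sq₀ (hfpos s).le (by positivity)).1 ?_
    rw [hf2 s hs, mul_pow, mul_pow, hk2]
    have h2 : T' s ≤ w' s ^ 2 := by
      rw [hw'sq s hs]; have := (hT s hs).1
      exact le_add_of_nonneg_right (by positivity)
    calc _ ≤ (m * Real.exp (-(w s ^ 2 / 2)) ^ 2) * (A / B) * w' s ^ 2 := by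
          exact mul_le_mul (mul_le_mul_of_nonneg_right (hfg s hs) (by positivity)) h2
            (hT'pos s).le (by positivity)
      _ = _ := by ring
  have hDmono : MonotoneOn D (Ioi 0) := by
    refine monotoneOn_of_deriv_nonneg (convex_Ioi 0)
      (fun s hs => (hDd s hs).continuousAt.continuousWithinAt) (fun s hs => ?_) (fun s hs => ?_)
    · rw [interior_Ioi] at hs
      exact (hDd s hs).differentiableAt.differentiableWithinAt
    · rw [interior_Ioi] at hs
      rw [(hDd s hs).deriv]; linarith [hle s hs]
  have hDnn : ∀ s > 0, 0 ≤ D s := fun s hs => by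
    have hFc : Tendsto F (𝓝[>] 0) (𝓝 0) := by
      have := (hasDerivAt_primitive hf 0).continuousAt.tendsto
      simp only [intervalIntegral.integral_same] at this
      exact this.mono_left nhdsWithin_le_nhds
    refine le_of_tendsto (f := fun u => -F u) (x := 𝓝[>] 0) (by simpa using hFc.neg) ?_
    filter_upwards [Ioo_mem_nhdsGT hs] with u hu
    refine le_trans ?_ (hDmono hu.1 hs hu.2.le)
    have := hEnn (w u) (hwpos u hu.1).le
    simp only [hD]; nlinarith
  have hDA : ∀ s > 0, D s ≤ k * √(Real.pi / 2) - A := fun s hs => by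
    have ht : Tendsto (fun u => k * √(Real.pi / 2) - F u) atTop (𝓝 (k * √(Real.pi / 2) - A)) :=
      hFt.const_sub _
    refine ge_of_tendsto ht ?_
    filter_upwards [eventually_ge_atTop s] with u hu
    refine (hDmono hs (hs.trans_le hu) hu).trans ?_
    simp only [hD]
    have := mul_le_mul_of_nonneg_left (hElt (w u)).le hkpos.le
    linarith
  have hAk : A ≤ k * √(Real.pi / 2) := by linarith [hDnn 1 one_pos, hDA 1 one_pos]
  have hsq : (k * √(Real.pi / 2)) ^ 2 = m * A / B * (Real.pi / 2) := by
    rw [mul_pow, hk2, Real.sq_sqrt (by positivity)]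
  have hAB : A * B ≤ m * (Real.pi / 2) ∧ (A * B = m * (Real.pi / 2) → A = k * √(Real.pi / 2)) := by
    constructor
    · have h1 : A ^ 2 ≤ m * A / B * (Real.pi / 2) := by rw [← hsq]; gcongr
      rw [div_mul_eq_mul_div, le_div_iff₀ hB] at h1
      nlinarith
    · intro he
      refine (sq_eq_sq₀ hA.le (by positivity)).1 ?_
      rw [hsq, eq_comm]
      field_simp
      linear_combination -2 * he
  refine ⟨hAB.1, fun he => ?_⟩
  have hAeq := hAB.2 he
  have hD0 : ∀ s > 0, D s = 0 := fun s hs => by linarith [hDnn s hs, hDA s hs]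
  have hfeq : ∀ s > 0, f s = k * (Real.exp (-(w s ^ 2 / 2)) * w' s) := fun s hs => by
    have h1 : HasDerivAt D 0 s := (hasDerivAt_const s (0 : ℝ)).congr_of_eventuallyEq
      (by filter_upwards [Ioi_mem_nhds hs] with u hu using hD0 u hu)
    linarith [(hDd s hs).unique h1]
  have hboth : ∀ s > 0, T s = s * T' s ∧ f s * g (T s) = m * Real.exp (-(s * T s)) := fun s hs => by
    have h1 := (hT s hs).1
    have h2 := congrArg (· ^ 2) (hfeq s hs)
    simp only [mul_pow, hk2] at h2
    rw [hf2 s hs, hw'sq s hs] at h2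
    have hx : Real.exp (-(w s ^ 2 / 2)) ^ 2 = Real.exp (-(s * T s)) := by
      rw [← Real.exp_nat_mul, hw2 s hs]; push_cast; ring_nf
    have h3 := hfg s hs
    rw [hx] at h2 h3
    have h4 := hT'pos s
    have h5 : 0 ≤ (T s - s * T' s) ^ 2 / (4 * (s * T s)) := by positivity
    have h6 := Real.exp_pos (-(s * T s))
    have h7 : 0 < A / B := by positivity
    have h2' : (f s * g (T s)) * T' s
        = m * Real.exp (-(s * T s)) * (T' s + (T s - s * T' s) ^ 2 / (4 * (s * T s))) := by
      refine mul_left_cancel₀ h7.ne' ?_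
      linear_combination h2
    have h8 : m * Real.exp (-(s * T s)) * ((T s - s * T' s) ^ 2 / (4 * (s * T s))) = 0 := by
      refine le_antisymm ?_ (by positivity)
      nlinarith [mul_le_mul_of_nonneg_right h3 h4.le]
    have h9 : (T s - s * T' s) ^ 2 / (4 * (s * T s)) = 0 := by
      rcases mul_eq_zero.1 h8 with h | h
      · exact absurd h (by positivity)
      · exact h
    refine ⟨?_, ?_⟩
    · have h10 : (T s - s * T' s) ^ 2 = 0 := by
        rcases div_eq_zero_iff.1 h9 with h | h
        · exact h
        · exact absurd h (by positivity)
      exact sub_eq_zero.1 (pow_eq_zero_iff two_ne_zero |>.1 h10)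
    · rw [h9, add_zero] at h2'
      exact mul_right_cancel₀ h4.ne' h2'
  have hlin : ∀ s > 0, T s = T 1 * s := by
    have hd : ∀ s > 0, HasDerivAt (fun u => T u / u) 0 s := fun s hs => by
      have := (hT s hs).2.div (hasDerivAt_id s) (ne_of_gt hs)
      refine this.congr_deriv ?_
      have h1 := (hboth s hs).1
      simp only [hT'] at h1
      rw [div_eq_zero_iff]
      left
      simp only [id]
      linear_combination -h1
    intro s hs
    have := isOpen_Ioi.is_const_of_deriv_eq_zero (isPreconnected_Ioi (a := (0:ℝ)))
      (fun u hu => (hd u hu).differentiableAt.differentiableWithinAt)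
      (fun u hu => (hd u hu).deriv) (mem_Ioi.2 hs) (mem_Ioi.2 one_pos)
    simp only [div_one] at this
    rw [← this]; field_simp [ne_of_gt hs]
  set l := T 1
  have hl : 0 < l := (hT 1 one_pos).1
  set a := √(m * A / B * l) with ha
  have hapos : 0 < a := Real.sqrt_pos.2 (by positivity)
  have ha2 : a ^ 2 = m * A / B * l := Real.sq_sqrt (by positivity)
  have hfa : ∀ s > 0, f s = a * Real.exp (-(l * s ^ 2 / 2)) := fun s hs => by
    refine (sq_eq_sq₀ (hfpos s).le (by positivity)).1 ?_
    have h1 : T' s = l := by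
      have := (hboth s hs).1
      rw [hlin s hs, mul_comm] at this
      exact (mul_left_cancel₀ (ne_of_gt hs) this).symm
    rw [hf2 s hs, (hboth s hs).2, h1, mul_pow, ha2, ← Real.exp_nat_mul, hlin s hs]
    push_cast
    rw [show (2 : ℝ) * -(l * s ^ 2 / 2) = -(s * (l * s)) by ring]
    ring
  refine ⟨l, hl, a, hapos, fun s hs => ⟨hfa s hs, ?_⟩⟩
  have hs' : 0 < s / l := div_pos hs hl
  have h1 := (hboth _ hs').2
  rw [hlin _ hs', hfa _ hs'] at h1
  have e1 : l * (s / l) = s := by field_simp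
  rw [e1] at h1
  have e2 : Real.exp (-(s / l * s)) =
      Real.exp (-(l * (s / l) ^ 2 / 2)) * Real.exp (-(s ^ 2 / (2 * l))) := by
    rw [← Real.exp_add]; congr 1; field_simp; ring
  rw [e2] at h1
  have h3 := Real.exp_pos (-(l * (s / l) ^ 2 / 2))
  rw [div_mul_eq_mul_div, eq_div_iff hapos.ne']
  refine mul_left_cancel₀ h3.ne' ?_
  linear_combination h1

/-! ### Continuous positive densities with superexponential decay -/

/-- Continuous positive functions decaying faster than `exp (-k ‖x‖)` for every `k`. -/
structure RapidDensity {E : Type*} [NormedAddCommGroup E] (f : E → ℝ) : Prop where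
  cont : Continuous f
  pos : ∀ x, 0 < f x
  decay : ∀ k : ℝ, 0 ≤ k → ∃ C : ℝ, 0 < C ∧ ∀ x, f x ≤ C * Real.exp (-(k * ‖x‖))

lemma integrable_exp_neg_norm {E : Type*} [NormedAddCommGroup E] [NormedSpace ℝ E]
    [FiniteDimensional ℝ E] [MeasurableSpace E] [BorelSpace E] (μ : Measure E)
    [μ.IsAddHaarMeasure] : Integrable (fun x : E => Real.exp (-‖x‖)) μ := by
  set r := Module.finrank ℝ E + 1 with hr
  have h := (integrable_one_add_norm (E := E) (μ := μ) (r := r)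
    (by rw [hr]; push_cast; linarith)).const_mul (Real.exp 1 * r.factorial)
  refine h.mono' (by fun_prop) (ae_of_all _ fun x => ?_)
  rw [Real.norm_of_nonneg (Real.exp_pos _).le, Real.rpow_neg (by positivity), Real.rpow_natCast]
  have h1 := Real.pow_div_factorial_le_exp (1 + ‖x‖) (by positivity) r
  rw [← div_eq_mul_inv, le_div_iff₀ (by positivity)]
  rw [div_le_iff₀ (by positivity)] at h1
  calc Real.exp (-‖x‖) * (1 + ‖x‖) ^ r
      ≤ Real.exp (-‖x‖) * (Real.exp (1 + ‖x‖) * r.factorial) := by gcongr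
    _ = Real.exp 1 * r.factorial := by
        rw [← mul_assoc, ← Real.exp_add]; congr 2; ring

namespace RapidDensity

lemma comp {E F : Type*} [NormedAddCommGroup E] [NormedAddCommGroup F] {f : F → ℝ}
    (hf : RapidDensity f) {T : E → F} (hT : Continuous T) {K M : ℝ} (hK : 0 ≤ K)
    (hb : ∀ x, ‖x‖ ≤ K * ‖T x‖ + M) : RapidDensity (fun x => f (T x)) where
  cont := hf.cont.comp hT
  pos x := hf.pos _
  decay k hk := by
    obtain ⟨C, hC, h⟩ := hf.decay (k * K) (by positivity)
    refine ⟨C * Real.exp (k * M), by positivity, fun x => (h _).trans ?_⟩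
    rw [mul_assoc C, ← Real.exp_add]
    gcongr
    nlinarith [mul_le_mul_of_nonneg_left (hb x) hk]

lemma mul_exp {E : Type*} [NormedAddCommGroup E] {f : E → ℝ} (hf : RapidDensity f) {l : E → ℝ}
    (hl : Continuous l) {K : ℝ} (hK : 0 ≤ K) (hb : ∀ x, l x ≤ K * ‖x‖) :
    RapidDensity (fun x => f x * Real.exp (l x)) where
  cont := hf.cont.mul (Real.continuous_exp.comp hl)
  pos x := mul_pos (hf.pos _) (Real.exp_pos _)
  decay k hk := by
    obtain ⟨C, hC, h⟩ := hf.decay (k + K) (by positivity)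
    refine ⟨C, hC, fun x => ?_⟩
    calc f x * Real.exp (l x) ≤ C * Real.exp (-((k + K) * ‖x‖)) * Real.exp (K * ‖x‖) := by
          gcongr
          · exact h x
          · exact hb x
      _ = _ := by rw [mul_assoc, ← Real.exp_add]; congr 2; ring

lemma const_mul {E : Type*} [NormedAddCommGroup E] {f : E → ℝ} (hf : RapidDensity f) {c : ℝ}
    (hc : 0 < c) : RapidDensity (fun x => c * f x) where
  cont := hf.cont.const_mul c
  pos x := mul_pos hc (hf.pos _)
  decay k hk := by
    obtain ⟨C, hC, h⟩ := hf.decay k hk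
    exact ⟨c * C, by positivity, fun x => by rw [mul_assoc]; gcongr; exact h x⟩

section Integrable

variable {E : Type*} [NormedAddCommGroup E] [NormedSpace ℝ E] [FiniteDimensional ℝ E]
  [MeasurableSpace E] [BorelSpace E] {f : E → ℝ}

lemma integrable_mul (hf : RapidDensity f) (μ : Measure E) [μ.IsAddHaarMeasure] {h : E → ℝ}
    (hc : Continuous h) {a : ℝ} (hb : ∀ x, |h x| ≤ a * (1 + ‖x‖)) :
    Integrable (fun x => h x * f x) μ := by
  obtain ⟨C, hC, hd⟩ := hf.decay 2 (by norm_num)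
  have ha : 0 ≤ a := by
    have := (abs_nonneg _).trans (hb 0); simpa using this
  refine ((integrable_exp_neg_norm μ).const_mul (a * C)).mono'
    (hc.mul hf.cont).aestronglyMeasurable (ae_of_all _ fun x => ?_)
  rw [norm_mul, Real.norm_eq_abs, Real.norm_of_nonneg (hf.pos x).le]
  have h1 : 1 + ‖x‖ ≤ Real.exp ‖x‖ := by linarith [Real.add_one_le_exp ‖x‖]
  calc |h x| * f x ≤ (a * Real.exp ‖x‖) * (C * Real.exp (-(2 * ‖x‖))) := by
        gcongr
        · exact (hf.pos x).le
        · exact (hb x).trans (by gcongr)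
        · exact hd x
    _ = a * C * (Real.exp ‖x‖ * Real.exp (-(2 * ‖x‖))) := by ring
    _ = _ := by rw [← Real.exp_add]; congr 2; ring

lemma integrable (hf : RapidDensity f) (μ : Measure E) [μ.IsAddHaarMeasure] : Integrable f μ := by
  have := hf.integrable_mul μ (h := fun _ => 1) continuous_const (a := 1)
    (fun x => by simp)
  simpa using this

lemma setIntegral_pos (hf : RapidDensity f) (μ : Measure E) [μ.IsAddHaarMeasure] {s : Set E}
    (hs : 0 < μ s) : 0 < ∫ x in s, f x ∂μ := by
  rw [setIntegral_pos_iff_support_of_nonneg_ae (ae_of_all _ fun x => (hf.pos x).le)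
    (hf.integrable μ).integrableOn]
  rwa [Function.support_eq_univ fun x => (hf.pos x).ne', univ_inter]

end Integrable

section Slice

variable {V : Type*} [NormedAddCommGroup V] {f : ℝ × V → ℝ}

lemma slice (hf : RapidDensity f) (x : V) : RapidDensity (fun s => f (s, x)) :=
  hf.comp (by fun_prop) (K := 1) (M := 0) zero_le_one fun s => by
    simp [Prod.norm_def]

lemma bound_slice (hf : RapidDensity f) {k : ℝ} (hk : 0 ≤ k) :
    ∃ C : ℝ, 0 < C ∧ ∀ s x, f (s, x) ≤ C * Real.exp (-‖s‖) * Real.exp (-(k * ‖x‖)) := by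
  obtain ⟨C, hC, h⟩ := hf.decay (1 + k) (by positivity)
  refine ⟨C, hC, fun s x => (h _).trans ?_⟩
  rw [mul_assoc, ← Real.exp_add]
  gcongr
  have h1 := le_max_left ‖s‖ ‖x‖
  have h2 := le_max_right ‖s‖ ‖x‖
  rw [Prod.norm_def]
  nlinarith

lemma integral_slice (hf : RapidDensity f) (S : Set ℝ) (hS : 0 < volume S) :
    RapidDensity (fun x => ∫ s in S, f (s, x)) where
  cont := by
    obtain ⟨C, hC, h⟩ := hf.bound_slice (le_refl 0)
    refine continuous_of_dominated (bound := fun s => C * Real.exp (-‖s‖)) (fun x => ?_)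
      (fun x => ?_) ?_ ?_
    · exact (hf.slice x).cont.aestronglyMeasurable
    · refine ae_of_all _ fun s => ?_
      rw [Real.norm_of_nonneg (hf.pos _).le]
      simpa using h s x
    · exact ((integrable_exp_neg_norm volume).const_mul C).integrableOn
    · exact ae_of_all _ fun s => hf.cont.comp (by fun_prop)
  pos x := (hf.slice x).setIntegral_pos volume hS
  decay k hk := by
    obtain ⟨C, hC, h⟩ := hf.bound_slice hk
    have hi : Integrable (fun s : ℝ => Real.exp (-‖s‖)) := integrable_exp_neg_norm volume
    have hp : 0 < ∫ s in S, Real.exp (-‖s‖) := by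
      rw [setIntegral_pos_iff_support_of_nonneg_ae (ae_of_all _ fun x => (Real.exp_pos _).le)
        hi.integrableOn]
      rwa [Function.support_eq_univ fun x => (Real.exp_pos _).ne', univ_inter]
    refine ⟨C * ∫ s in S, Real.exp (-‖s‖), by positivity, fun x => ?_⟩
    rw [← integral_const_mul, ← integral_mul_const]
    refine integral_mono ((hf.slice x).integrable volume).integrableOn ?_ fun s => h s x
    exact ((hi.const_mul C).mul_const _).integrableOn

end Slice

end RapidDensity

/-! ### The functional inequality: half-space step -/

/-- A pair of Gaussian functions that are dual to each other. -/
def IsDualGaussianPair {n : ℕ} (f g : (Fin n → ℝ) → ℝ) : Prop :=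
  ∃ (P R : (Fin n → ℝ) →ₗ[ℝ] (Fin n → ℝ)) (a : ℝ), 0 < a ∧ (∀ x y, P x ⬝ᵥ R y = x ⬝ᵥ y) ∧
    (∀ x, f x = a * Real.exp (-(P x ⬝ᵥ P x / 2))) ∧
    (∀ y, g y = a⁻¹ * Real.exp (-(R y ⬝ᵥ R y / 2)))

/-- The Gaussian functional Santaló inequality in dimension `n`, for a centered first function,
together with its equality case. -/
def FunctionalSantalo (n : ℕ) : Prop :=
  ∀ f g : (Fin n → ℝ) → ℝ, RapidDensity f → RapidDensity g →
    (∀ x y, f x * g y ≤ Real.exp (-(x ⬝ᵥ y))) → (∀ i, ∫ x, x i * f x = 0) →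
    (∫ x, f x) * (∫ y, g y) ≤ (2 * Real.pi) ^ n ∧
    ((∫ x, f x) * (∫ y, g y) = (2 * Real.pi) ^ n → IsDualGaussianPair f g)

lemma IsDualGaussianPair.symm {n : ℕ} {f g : (Fin n → ℝ) → ℝ} (h : IsDualGaussianPair f g) :
    IsDualGaussianPair g f := by
  obtain ⟨P, R, a, ha, hPR, hf, hg⟩ := h
  exact ⟨R, P, a⁻¹, by positivity,
    fun x y => by rw [dotProduct_comm, hPR, dotProduct_comm], hg, by simpa using hf⟩

lemma injective_of_dotProduct_eq {n : ℕ} {P R : (Fin n → ℝ) →ₗ[ℝ] (Fin n → ℝ)}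
    (h : ∀ x y, P x ⬝ᵥ R y = x ⬝ᵥ y) : Function.Injective R := by
  rw [← LinearMap.ker_eq_bot, LinearMap.ker_eq_bot']
  intro y hy
  have := h y y
  rw [hy, dotProduct_zero] at this
  exact dotProduct_self_eq_zero.1 this.symm

lemma surjective_of_dotProduct_eq {n : ℕ} {P R : (Fin n → ℝ) →ₗ[ℝ] (Fin n → ℝ)}
    (h : ∀ x y, P x ⬝ᵥ R y = x ⬝ᵥ y) : Function.Surjective R :=
  LinearMap.injective_iff_surjective.1 (injective_of_dotProduct_eq h)

lemma nonpos_of_mul_exp_le {A B d : ℝ} (hA : 0 < A)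
    (h : ∀ s > 0, A * Real.exp (d * s ^ 2) ≤ B) : d ≤ 0 := by
  by_contra! hd
  have hB : 0 < B := (mul_pos hA (Real.exp_pos _)).trans_le (h 1 one_pos)
  set s := B / (A * d) + 1 with hs
  have hs1 : 1 ≤ s := by rw [hs]; linarith [div_pos hB (mul_pos hA hd)]
  have h1 := h s (by linarith)
  have h2 : A * (d * s) = B + A * d := by rw [hs]; field_simp
  have h3 := Real.add_one_le_exp (d * s ^ 2)
  have h4 : d * s ≤ d * s ^ 2 := by nlinarith
  nlinarith [mul_pos hA hd]

lemma integral_exp_neg_mul_sq_Ioi (l : ℝ) :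
    ∫ s in Ioi (0 : ℝ), Real.exp (-(l * s ^ 2 / 2)) = √(Real.pi / (l / 2)) / 2 := by
  rw [← integral_gaussian_Ioi]
  congr 1 with s
  ring_nf

theorem half_space_santalo {n : ℕ} (hS : FunctionalSantalo n) {f g : ℝ × (Fin n → ℝ) → ℝ}
    (hf : RapidDensity f) (hg : RapidDensity g)
    (h : ∀ s > 0, ∀ t > 0, ∀ x y, f (s, x) * g (t, y) ≤ Real.exp (-(s * t + x ⬝ᵥ y)))
    (hc : ∀ i, ∫ x : Fin n → ℝ, x i * ∫ s in Ioi 0, f (s, x) = 0) :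
    (∫ x, ∫ s in Ioi 0, f (s, x)) * (∫ y, ∫ t in Ioi 0, g (t, y))
      ≤ Real.pi / 2 * (2 * Real.pi) ^ n ∧
    ((∫ x, ∫ s in Ioi 0, f (s, x)) * (∫ y, ∫ t in Ioi 0, g (t, y))
      = Real.pi / 2 * (2 * Real.pi) ^ n →
      ∃ (P R : (Fin n → ℝ) →ₗ[ℝ] (Fin n → ℝ)) (a l : ℝ), 0 < a ∧ 0 < l ∧
        (∀ x y, P x ⬝ᵥ R y = x ⬝ᵥ y) ∧
        (∀ s ≥ 0, ∀ x, f (s, x) =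
          a * Real.exp (-(l * s ^ 2 / 2)) * Real.exp (-(P x ⬝ᵥ P x / 2))) ∧
        (∀ t ≥ 0, ∀ y, g (t, y) =
          a⁻¹ * Real.exp (-(t ^ 2 / (2 * l))) * Real.exp (-(R y ⬝ᵥ R y / 2)))) := by
  have hvol : (0 : ℝ≥0∞) < volume (Ioi (0 : ℝ)) := by simp
  have hF := hf.integral_slice _ hvol
  have hG := (hg.integral_slice _ hvol).const_mul (c := 2 / Real.pi) (by positivity)
  have hpi : 0 < Real.pi / 2 := by positivity
  have hline := fun x y => half_line_santalo (hf.slice x).cont (hg.slice y).cont (hf.slice x).pos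
    (hg.slice y).pos ((hf.slice x).integrable volume).integrableOn
    ((hg.slice y).integrable volume).integrableOn (Real.exp_pos (-(x ⬝ᵥ y))) (by
      intro s hs t ht
      rw [← Real.exp_add]
      refine (h s hs t ht x y).trans (le_of_eq ?_)
      congr 1; ring)
  have hmain := hS _ _ hF hG (fun x y => by
    have h1 := (hline x y).1
    calc _ = 2 / Real.pi * ((∫ s in Ioi 0, f (s, x)) * ∫ t in Ioi 0, g (t, y)) := by ring
      _ ≤ 2 / Real.pi * (Real.exp (-(x ⬝ᵥ y)) * (Real.pi / 2)) := by gcongr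
      _ = _ := by field_simp) hc
  rw [integral_const_mul] at hmain
  set I := ∫ x, ∫ s in Ioi 0, f (s, x)
  set J := ∫ y, ∫ t in Ioi 0, g (t, y)
  have e1 : I * (2 / Real.pi * J) = 2 / Real.pi * (I * J) := by ring
  rw [e1] at hmain
  refine ⟨?_, fun he => ?_⟩
  · have := mul_le_mul_of_nonneg_left hmain.1 hpi.le
    calc I * J = Real.pi / 2 * (2 / Real.pi * (I * J)) := by field_simp
      _ ≤ _ := this
  obtain ⟨P, R, b, hb, hPR, hfP, hgR⟩ := hmain.2 (by rw [he]; field_simp)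
  beta_reduce at hfP hgR
  have hRs := surjective_of_dotProduct_eq hPR
  have hRi := injective_of_dotProduct_eq hPR
  have hRP : ∀ x y, R x ⬝ᵥ P y = x ⬝ᵥ y := fun x y => by
    rw [dotProduct_comm, hPR, dotProduct_comm]
  have hPs := surjective_of_dotProduct_eq hRP
  have hloc : ∀ x, ∃ y, R y = P x ∧ ∃ l > 0, ∃ a > 0, ∀ s > 0,
      f (s, x) = a * Real.exp (-(l * s ^ 2 / 2)) ∧
      g (s, y) = Real.exp (-(x ⬝ᵥ y)) / a * Real.exp (-(s ^ 2 / (2 * l))) := by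
    intro x
    obtain ⟨y, hy⟩ := hRs (P x)
    refine ⟨y, hy, (hline x y).2 ?_⟩
    have h1 := hfP x
    have h2 := hgR y
    rw [hy] at h2
    have h3 : Real.exp (-(x ⬝ᵥ y)) =
        Real.exp (-(P x ⬝ᵥ P x / 2)) * Real.exp (-(P x ⬝ᵥ P x / 2)) := by
      rw [← Real.exp_add, ← hPR, hy]; congr 1; ring
    rw [h3, h1]
    have h4 : ∫ t in Ioi 0, g (t, y) = Real.pi / 2 * (b⁻¹ * Real.exp (-(P x ⬝ᵥ P x / 2))) := by
      rw [← h2]; field_simp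
    rw [h4]; field_simp
  choose Y hY l hl α hα hfg using hloc
  have hlle : ∀ x₁ x₂, l x₁ ≤ l x₂ := by
    intro x₁ x₂
    have hA : 0 < α x₂ * (Real.exp (-(x₁ ⬝ᵥ Y x₁)) / α x₁) := by
      have := hα x₁; have := hα x₂; positivity
    have := nonpos_of_mul_exp_le (d := (l x₁ - l x₂) / 2) (B := Real.exp (-(x₂ ⬝ᵥ Y x₁))) hA ?_
    · linarith
    intro s hs
    have hl1 := hl x₁
    have h1 := h s hs (l x₁ * s) (by positivity) x₂ (Y x₁)
    rw [(hfg x₂ s hs).1, (hfg x₁ (l x₁ * s) (by positivity)).2, neg_add, Real.exp_add] at h1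
    have e2 : (l x₁ * s) ^ 2 / (2 * l x₁) = l x₁ * s ^ 2 / 2 := by field_simp
    rw [e2] at h1
    have e3 : Real.exp ((l x₁ - l x₂) / 2 * s ^ 2) * Real.exp (-(s * (l x₁ * s))) =
        Real.exp (-(l x₂ * s ^ 2 / 2)) * Real.exp (-(l x₁ * s ^ 2 / 2)) := by
      rw [← Real.exp_add, ← Real.exp_add]; congr 1; ring
    refine le_of_mul_le_mul_right ?_ (Real.exp_pos (-(s * (l x₁ * s))))
    rw [mul_assoc, e3]
    linarith
  have hlc : ∀ x, l x = l 0 := fun x => le_antisymm (hlle _ _) (hlle _ _)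
  set L := l 0
  have hL : 0 < L := hl 0
  set q := √(Real.pi / (L / 2)) / 2 with hq
  have hqpos : 0 < q := by positivity
  have hαx : ∀ x, α x = b / q * Real.exp (-(P x ⬝ᵥ P x / 2)) := fun x => by
    have h1 : ∫ s in Ioi 0, f (s, x) = α x * q := by
      rw [hq, ← integral_exp_neg_mul_sq_Ioi, ← integral_const_mul]
      refine setIntegral_congr_fun measurableSet_Ioi fun s hs => ?_
      rw [← hlc x]
      exact (hfg x s hs).1
    have h2 := hfP x
    rw [h1] at h2
    rw [div_mul_eq_mul_div, ← h2]; field_simp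
  refine ⟨P, R, b / q, L, by positivity, hL, hPR, fun s hs x => ?_, fun t ht y => ?_⟩
  · have : EqOn (fun s => f (s, x)) (fun s =>
        b / q * Real.exp (-(L * s ^ 2 / 2)) * Real.exp (-(P x ⬝ᵥ P x / 2))) (Ioi 0) := by
      intro s hs
      simp only []
      rw [(hfg x s hs).1, hαx, hlc]; ring
    have h2 := this.closure (hf.slice x).cont (by fun_prop)
    rw [closure_Ioi] at h2
    exact h2 hs
  · have : EqOn (fun t => g (t, y)) (fun t =>
        (b / q)⁻¹ * Real.exp (-(t ^ 2 / (2 * L))) * Real.exp (-(R y ⬝ᵥ R y / 2))) (Ioi 0) := by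
      intro t ht
      obtain ⟨x, hx⟩ := hPs (R y)
      have hyx : Y x = y := hRi (by rw [hY, hx])
      have h1 := (hfg x t ht).2
      rw [hyx, hlc, hαx, ← hPR, hx] at h1
      simp only []
      rw [h1]
      have e4 : Real.exp (-(R y ⬝ᵥ R y)) = Real.exp (-(R y ⬝ᵥ R y / 2)) *
          Real.exp (-(R y ⬝ᵥ R y / 2)) := by rw [← Real.exp_add]; congr 1; ring
      rw [e4]; field_simp
    have h2 := this.closure (hg.slice y).cont (by fun_prop)
    rw [closure_Ioi] at h2
    exact h2 ht

theorem split_space_santalo {n : ℕ} (hS : FunctionalSantalo n) {f g : ℝ × (Fin n → ℝ) → ℝ}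
    (hf : RapidDensity f) (hg : RapidDensity g)
    (h : ∀ q r, f q * g r ≤ Real.exp (-(q.1 * r.1 + q.2 ⬝ᵥ r.2)))
    (hhalf : ∫ x, ∫ s in Ioi 0, f (s, x) = ∫ x, ∫ s in Iic 0, f (s, x))
    (hc₁ : ∀ i, ∫ x : Fin n → ℝ, x i * ∫ s in Ioi 0, f (s, x) = 0)
    (hc₂ : ∀ i, ∫ x : Fin n → ℝ, x i * ∫ s in Iic 0, f (s, x) = 0) :
    (∫ q, f q) * (∫ r, g r) ≤ (2 * Real.pi) ^ (n + 1) ∧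
    ((∫ q, f q) * (∫ r, g r) = (2 * Real.pi) ^ (n + 1) →
      ∃ (P R : (Fin n → ℝ) →ₗ[ℝ] (Fin n → ℝ)) (a l : ℝ), 0 < a ∧ 0 < l ∧
        (∀ x y, P x ⬝ᵥ R y = x ⬝ᵥ y) ∧
        (∀ s x, f (s, x) =
          a * Real.exp (-(l * s ^ 2 / 2)) * Real.exp (-(P x ⬝ᵥ P x / 2))) ∧
        (∀ t y, g (t, y) =
          a⁻¹ * Real.exp (-(t ^ 2 / (2 * l))) * Real.exp (-(R y ⬝ᵥ R y / 2)))) := by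
  have hvol : (0 : ℝ≥0∞) < volume (Ioi (0 : ℝ)) := by simp
  have hvol' : (0 : ℝ≥0∞) < volume (Iic (0 : ℝ)) := by simp
  have hneg : ∀ {u : ℝ × (Fin n → ℝ) → ℝ}, RapidDensity u →
      RapidDensity (fun q : ℝ × (Fin n → ℝ) => u (-q.1, q.2)) := fun hu =>
    hu.comp (by fun_prop) (K := 1) (M := 0) zero_le_one fun q => by simp [Prod.norm_def]
  have hflip : ∀ (u : ℝ × (Fin n → ℝ) → ℝ) x,
      ∫ s in Ioi 0, u (-s, x) = ∫ s in Iic 0, u (s, x) := fun u x => by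
    simpa using integral_comp_neg_Ioi 0 (fun s => u (s, x))
  have hp := half_space_santalo hS hf hg (fun s _ t _ x y => h (s, x) (t, y)) hc₁
  have hn := half_space_santalo hS (hneg hf) (hneg hg)
    (fun s _ t _ x y => by simpa using h (-s, x) (-t, y))
    (fun i => by simp only [hflip f]; exact hc₂ i)
  simp only [hflip f, hflip g] at hn
  have hsplit : ∀ {u : ℝ × (Fin n → ℝ) → ℝ}, RapidDensity u → ∫ q, u q =
      (∫ x, ∫ s in Ioi 0, u (s, x)) + ∫ x, ∫ s in Iic 0, u (s, x) := fun {u} hu => by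
    rw [← integral_add ((hu.integral_slice _ hvol).integrable volume)
      ((hu.integral_slice _ hvol').integrable volume), Measure.volume_eq_prod,
      integral_prod_symm _ (hu.integrable _)]
    congr 1 with x
    rw [← compl_Ioi, integral_add_compl measurableSet_Ioi ((hu.slice x).integrable _)]
  rw [hsplit hf, hsplit hg]
  have hMpos : 0 < ∫ x, ∫ s in Ioi 0, f (s, x) := by
    have := (hf.integral_slice _ hvol).setIntegral_pos volume (s := univ)
      (isOpen_univ.measure_pos volume univ_nonempty)
    simpa using this
  rw [← hhalf] at hn ⊢
  set M := ∫ x, ∫ s in Ioi 0, f (s, x) with hM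
  set J₁ := ∫ x, ∫ s in Ioi 0, g (s, x)
  set J₂ := ∫ x, ∫ s in Iic 0, g (s, x)
  have e : (2 * Real.pi) ^ (n + 1) =
      2 * (Real.pi / 2 * (2 * Real.pi) ^ n) + 2 * (Real.pi / 2 * (2 * Real.pi) ^ n) := by
    rw [pow_succ]; ring
  rw [e]
  refine ⟨by nlinarith [hp.1, hn.1], fun he => ?_⟩
  obtain ⟨P₁, R₁, a₁, l₁, ha₁, hl₁, hPR₁, hf₁, hg₁⟩ := hp.2 (by nlinarith [hp.1, hn.1])
  obtain ⟨P₂, R₂, a₂, l₂, ha₂, hl₂, hPR₂, hf₂, hg₂⟩ := hn.2 (by nlinarith [hp.1, hn.1])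
  have hfa : ∀ x, a₁ * Real.exp (-(P₁ x ⬝ᵥ P₁ x / 2)) = a₂ * Real.exp (-(P₂ x ⬝ᵥ P₂ x / 2)) :=
    fun x => by
      have h1 := hf₁ 0 le_rfl x
      have h2 := hf₂ 0 le_rfl x
      simp only [neg_zero] at h2
      rw [h1] at h2
      simpa using h2
  have hga : ∀ x, a₁⁻¹ * Real.exp (-(R₁ x ⬝ᵥ R₁ x / 2)) =
      a₂⁻¹ * Real.exp (-(R₂ x ⬝ᵥ R₂ x / 2)) := fun x => by
    have h1 := hg₁ 0 le_rfl x
    have h2 := hg₂ 0 le_rfl x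
    simp only [neg_zero] at h2
    rw [h1] at h2
    simpa using h2
  have haa : a₁ = a₂ := by simpa using hfa 0
  subst haa
  have hPP : ∀ x, Real.exp (-(P₁ x ⬝ᵥ P₁ x / 2)) = Real.exp (-(P₂ x ⬝ᵥ P₂ x / 2)) :=
    fun x => mul_left_cancel₀ ha₁.ne' (hfa x)
  have hRR : ∀ x, Real.exp (-(R₁ x ⬝ᵥ R₁ x / 2)) = Real.exp (-(R₂ x ⬝ᵥ R₂ x / 2)) :=
    fun x => mul_left_cancel₀ (inv_pos.2 ha₁).ne' (hga x)
  have hmass : ∀ {u : ℝ × (Fin n → ℝ) → ℝ} {l : ℝ}, (∀ s ≥ 0, ∀ x, u (s, x) =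
      a₁ * Real.exp (-(l * s ^ 2 / 2)) * Real.exp (-(P₁ x ⬝ᵥ P₁ x / 2))) →
      ∫ x, ∫ s in Ioi 0, u (s, x) = a₁ * (√(Real.pi / (l / 2)) / 2) *
        ∫ x, Real.exp (-(P₁ x ⬝ᵥ P₁ x / 2)) := fun {u l} hu => by
    rw [← integral_const_mul]
    congr 1 with x
    rw [← integral_exp_neg_mul_sq_Ioi, ← integral_const_mul, ← integral_mul_const]
    exact setIntegral_congr_fun measurableSet_Ioi fun s hs => hu s (le_of_lt hs) x
  have hm₁ := hmass hf₁
  have hm₂ := hmass (u := fun q => f (-q.1, q.2)) (l := l₂)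
    (fun s hs x => by rw [hPP]; exact hf₂ s hs x)
  simp only [hflip f] at hm₂
  rw [← hhalf] at hm₂
  rw [← hM] at hm₁
  have hll : l₁ = l₂ := by
    have hZ : (∫ x, Real.exp (-(P₁ x ⬝ᵥ P₁ x / 2))) ≠ 0 := fun h0 => by
      rw [h0, mul_zero] at hm₁; exact hMpos.ne' hm₁
    rw [hm₁] at hm₂
    have h1 := mul_left_cancel₀ ha₁.ne' (mul_right_cancel₀ hZ hm₂)
    have h2 : √(Real.pi / (l₁ / 2)) = √(Real.pi / (l₂ / 2)) := by linarith
    rw [Real.sqrt_inj (by positivity) (by positivity)] at h2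
    field_simp at h2
    linarith
  subst hll
  refine ⟨P₁, R₁, a₁, l₁, ha₁, hl₁, hPR₁, fun s x => ?_, fun t y => ?_⟩
  · rcases le_total 0 s with hs | hs
    · exact hf₁ s hs x
    · have := hf₂ (-s) (by simpa using hs) x
      simpa [hPP] using this
  · rcases le_total 0 t with ht | ht
    · exact hg₁ t ht y
    · have := hg₂ (-t) (by simpa using ht) y
      simpa [hRR] using this

/-! ### Aligning the halves of a density, and the induction on the dimension -/

instance isAddHaarMeasure_volume_prod {n : ℕ} :
    (volume : Measure (ℝ × (Fin n → ℝ))).IsAddHaarMeasure :=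
  inferInstanceAs ((volume : Measure ℝ).prod (volume : Measure (Fin n → ℝ))).IsAddHaarMeasure

lemma exists_integral_Ioi_eq_integral_Iic {m : ℝ → ℝ} (hm : Integrable m) (h0 : 0 < ∫ s, m s) :
    ∃ c, ∫ s in Ioi c, m s = ∫ s in Iic c, m s := by
  have hsum : ∀ c, (∫ s in Ioi c, m s) + ∫ s in Iic c, m s = ∫ s, m s := fun c => by
    rw [← compl_Ioi, integral_add_compl measurableSet_Ioi hm]
  have hG : ∀ c, (∫ s in (0 : ℝ)..c, m s) + ∫ s in Iic 0, m s = ∫ s in Iic c, m s := fun c => by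
    rw [← intervalIntegral.integral_Iic_sub_Iic hm.integrableOn hm.integrableOn]; ring
  have hcont : Continuous fun c => ∫ s in Iic c, m s := by
    have : (fun c => ∫ s in Iic c, m s) =
        fun c => (∫ s in (0 : ℝ)..c, m s) + ∫ s in Iic 0, m s := funext fun c => (hG c).symm
    rw [this]
    exact (intervalIntegral.continuous_primitive
      (fun a b => hm.intervalIntegrable) 0).add_const _
  have htop : Tendsto (fun c => ∫ s in Iic c, m s) atTop (𝓝 (∫ s, m s)) := by
    have h1 := (intervalIntegral_tendsto_integral_Ioi 0 hm.integrableOn tendsto_id).add_const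
      (∫ s in Iic 0, m s)
    simpa only [id, hG, hsum] using h1
  have hbot : Tendsto (fun c => ∫ s in Iic c, m s) atBot (𝓝 0) := by
    have h1 := ((intervalIntegral_tendsto_integral_Iic 0 hm.integrableOn tendsto_id).neg).add_const
      (∫ s in Iic 0, m s)
    simp only [← intervalIntegral.integral_symm, id, hG, neg_add_cancel] at h1
    exact h1
  obtain ⟨c, hc⟩ := mem_range_of_exists_le_of_exists_ge hcont
    ((hbot.eventually (ge_mem_nhds (half_pos h0))).exists)
    ((htop.eventually (le_mem_nhds (half_lt_self h0))).exists)
  exact ⟨c, by linarith [hsum c]⟩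

lemma abs_dotProduct_le_sum_mul_norm {n : ℕ} (w y : Fin n → ℝ) :
    |w ⬝ᵥ y| ≤ (∑ i, |w i|) * ‖y‖ := by
  rw [dotProduct, Finset.sum_mul]
  refine (Finset.abs_sum_le_sum_abs _ _).trans (Finset.sum_le_sum fun i _ => ?_)
  rw [abs_mul]
  gcongr
  exact norm_le_pi_norm y i

lemma continuous_dotProduct_left {n : ℕ} (w : Fin n → ℝ) : Continuous fun y => w ⬝ᵥ y := by
  unfold dotProduct; fun_prop

lemma RapidDensity.shear {V : Type*} [NormedAddCommGroup V] [NormedSpace ℝ V] {f : ℝ × V → ℝ}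
    (hf : RapidDensity f) (c : ℝ) (p w : V) :
    RapidDensity fun q : ℝ × V => f (c + q.1, p + q.2 + q.1 • w) := by
  refine hf.comp (T := fun q : ℝ × V => (c + q.1, p + q.2 + q.1 • w)) (by fun_prop)
    (K := 1 + ‖w‖) (M := |c| * (1 + ‖w‖) + ‖p‖) (by positivity) fun q => ?_
  have h1 : |c + q.1| ≤ ‖(c + q.1, p + q.2 + q.1 • w)‖ := le_max_left _ _
  have h2 : ‖p + q.2 + q.1 • w‖ ≤ ‖(c + q.1, p + q.2 + q.1 • w)‖ := le_max_right _ _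
  have h3 : |q.1| ≤ |c + q.1| + |c| := by
    simpa using abs_sub (c + q.1) c
  have h4 : ‖q.2‖ ≤ ‖p + q.2 + q.1 • w‖ + ‖p‖ + |q.1| * ‖w‖ := by
    calc ‖q.2‖ = ‖p + q.2 + q.1 • w - p - q.1 • w‖ := by congr 1; abel
      _ ≤ _ := (norm_sub_le _ _).trans (by
        rw [norm_smul, Real.norm_eq_abs]; gcongr; exact norm_sub_le _ _)
  set N := ‖(c + q.1, p + q.2 + q.1 • w)‖
  have hN : 0 ≤ N := norm_nonneg _
  have hw := norm_nonneg w
  have hp := norm_nonneg p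
  have hc := abs_nonneg c
  rw [Prod.norm_def]
  refine max_le ?_ ?_
  · rw [Real.norm_eq_abs]; nlinarith [mul_nonneg hN hw, mul_nonneg hc hw]
  · nlinarith [mul_le_mul_of_nonneg_right h3 hw, mul_le_mul_of_nonneg_right h1 hw]

lemma RapidDensity.shear_fst {n : ℕ} {g : ℝ × (Fin n → ℝ) → ℝ}
    (hg : RapidDensity g) (w : Fin n → ℝ) :
    RapidDensity fun q : ℝ × (Fin n → ℝ) => g (q.1 - w ⬝ᵥ q.2, q.2) := by
  have hcw := (continuous_dotProduct_left w).comp (continuous_snd (X := ℝ))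
  refine hg.comp (T := fun q : ℝ × (Fin n → ℝ) => (q.1 - w ⬝ᵥ q.2, q.2))
    ((continuous_fst.sub hcw).prodMk continuous_snd)
    (K := 1 + ∑ i, |w i|) (M := 0) (by positivity) fun q => ?_
  have h1 : |q.1 - w ⬝ᵥ q.2| ≤ ‖(q.1 - w ⬝ᵥ q.2, q.2)‖ := le_max_left _ _
  have h2 : ‖q.2‖ ≤ ‖(q.1 - w ⬝ᵥ q.2, q.2)‖ := le_max_right _ _
  have h3 : |q.1| ≤ |q.1 - w ⬝ᵥ q.2| + |w ⬝ᵥ q.2| := by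
    simpa using abs_add_le (q.1 - w ⬝ᵥ q.2) (w ⬝ᵥ q.2)
  have h4 := abs_dotProduct_le_sum_mul_norm w q.2
  set N := ‖(q.1 - w ⬝ᵥ q.2, q.2)‖
  have hN : 0 ≤ N := norm_nonneg _
  have hw : 0 ≤ ∑ i, |w i| := by positivity
  rw [Prod.norm_def]
  refine max_le ?_ ?_
  · rw [Real.norm_eq_abs]; nlinarith
  · nlinarith [mul_nonneg hN hw]

lemma integral_setIntegral_eq {n : ℕ} {F : ℝ × (Fin n → ℝ) → ℝ} (hF : Integrable F) (S : Set ℝ) :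
    ∫ x, ∫ s in S, F (s, x) = ∫ q in S ×ˢ univ, F q := by
  have h := hF.integrableOn (s := S ×ˢ univ)
  rw [IntegrableOn, Measure.volume_eq_prod, ← Measure.prod_restrict, Measure.restrict_univ] at h
  rw [Measure.volume_eq_prod, ← Measure.prod_restrict, Measure.restrict_univ,
    integral_prod_symm _ h]

lemma setIntegral_prod_univ_eq {n : ℕ} {F : ℝ × (Fin n → ℝ) → ℝ} (hF : Integrable F) (S : Set ℝ) :
    ∫ q in S ×ˢ univ, F q = ∫ s in S, ∫ x, F (s, x) := by
  have h := hF.integrableOn (s := S ×ˢ univ)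
  rw [IntegrableOn, Measure.volume_eq_prod, ← Measure.prod_restrict, Measure.restrict_univ] at h
  rw [Measure.volume_eq_prod, ← Measure.prod_restrict, Measure.restrict_univ, integral_prod _ h]

lemma setIntegral_shear {n : ℕ} {F : ℝ × (Fin n → ℝ) → ℝ} {p w : Fin n → ℝ} (S : Set ℝ)
    (hF : Integrable F) (hF' : Integrable fun q : ℝ × (Fin n → ℝ) => F (q.1, p + q.2 + q.1 • w)) :
    ∫ q in S ×ˢ univ, F (q.1, p + q.2 + q.1 • w) = ∫ q in S ×ˢ univ, F q := by
  rw [setIntegral_prod_univ_eq hF, setIntegral_prod_univ_eq hF']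
  congr 1 with s
  have : ∀ x, p + x + s • w = x + (p + s • w) := fun x => by abel
  simp only [this]
  exact integral_add_right_eq_self (fun x => F (s, x)) _

lemma integral_shear_fst {n : ℕ} {F : ℝ × (Fin n → ℝ) → ℝ} {w : Fin n → ℝ}
    (hF : Integrable F) (hF' : Integrable fun q : ℝ × (Fin n → ℝ) => F (q.1 - w ⬝ᵥ q.2, q.2)) :
    ∫ q : ℝ × (Fin n → ℝ), F (q.1 - w ⬝ᵥ q.2, q.2) = ∫ q, F q := by
  rw [Measure.volume_eq_prod] at *
  rw [integral_prod_symm _ hF, integral_prod_symm _ hF']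
  congr 1 with y
  exact integral_sub_right_eq_self (μ := volume) (fun t : ℝ => F (t, y)) (w ⬝ᵥ y)

lemma RapidDensity.integral_le_integral_mul_exp {E : Type*} [NormedAddCommGroup E]
    [NormedSpace ℝ E] [FiniteDimensional ℝ E] [MeasureSpace E] [BorelSpace E]
    [(volume : Measure E).IsAddHaarMeasure] {g : E → ℝ} (hg : RapidDensity g) (l : E →L[ℝ] ℝ)
    (hc : ∫ r, l r * g r = 0) :
    ∫ r, g r ≤ ∫ r, g r * Real.exp (l r) ∧
      (∫ r, g r = ∫ r, g r * Real.exp (l r) → l = 0) := by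
  have hl : ∀ x, |l x| ≤ ‖l‖ * ‖x‖ := l.le_opNorm
  have h1 := hg.integrable (volume : Measure E)
  have h2 : Integrable fun r => l r * g r :=
    hg.integrable_mul volume l.continuous (a := ‖l‖) fun x => (hl x).trans (by
      gcongr; linarith)
  have h3 := (hg.mul_exp l.continuous (norm_nonneg l)
    fun x => (le_abs_self _).trans (hl x)).integrable (volume : Measure E)
  have h0 : ∀ r, 0 ≤ g r * Real.exp (l r) - g r - l r * g r := fun r => by
    nlinarith [hg.pos r, Real.add_one_le_exp (l r)]
  have h4 : Integrable fun r => g r * Real.exp (l r) - g r - l r * g r := (h3.sub h1).sub h2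
  have he : ∫ r, (g r * Real.exp (l r) - g r - l r * g r) =
      (∫ r, g r * Real.exp (l r)) - ∫ r, g r := by
    have h5 := integral_sub (h3.sub h1) h2
    simp only [Pi.sub_apply] at h5
    rw [h5, integral_sub h3 h1, hc, sub_zero]
  have hnn : 0 ≤ ∫ r, (g r * Real.exp (l r) - g r - l r * g r) := integral_nonneg h0
  rw [he] at hnn
  refine ⟨by linarith, fun heq => ?_⟩
  rw [heq, sub_self, integral_eq_zero_iff_of_nonneg h0 h4] at he
  have hz := (Continuous.ae_eq_iff_eq volume (by have := hg.cont; fun_prop)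
    continuous_const).1 he
  ext r
  have : g r * Real.exp (l r) - g r - l r * g r = 0 := congrFun hz r
  by_contra hne
  have h5 := Real.add_one_lt_exp (x := l r) (by simpa using hne)
  nlinarith [hg.pos r]

theorem sheared_santalo {n : ℕ} (hS : FunctionalSantalo n) {f g : ℝ × (Fin n → ℝ) → ℝ}
    (hf : RapidDensity f) (hg : RapidDensity g)
    (h : ∀ q r, f q * g r ≤ Real.exp (-(q.1 * r.1 + q.2 ⬝ᵥ r.2)))
    (hc₀ : ∫ r, r.1 * g r = 0) (hc : ∀ i, ∫ r, r.2 i * g r = 0) :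
    (∫ q, f q) * (∫ r, g r) ≤ (2 * Real.pi) ^ (n + 1) ∧
    ((∫ q, f q) * (∫ r, g r) = (2 * Real.pi) ^ (n + 1) →
      ∃ (P R : (Fin n → ℝ) →ₗ[ℝ] (Fin n → ℝ)) (w : Fin n → ℝ) (a l : ℝ), 0 < a ∧ 0 < l ∧
        (∀ x y, P x ⬝ᵥ R y = x ⬝ᵥ y) ∧
        (∀ s x, f (s, x) = a * Real.exp (-(l * s ^ 2 / 2)) *
          Real.exp (-(P (x - s • w) ⬝ᵥ P (x - s • w) / 2))) ∧
        (∀ t y, g (t, y) = a⁻¹ * Real.exp (-((t + w ⬝ᵥ y) ^ 2 / (2 * l))) *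
          Real.exp (-(R y ⬝ᵥ R y / 2)))) := by
  have hfi := hf.integrable volume
  have hfpos : 0 < ∫ q, f q := by
    simpa using hf.setIntegral_pos volume (isOpen_univ.measure_pos volume univ_nonempty)
  -- the median hyperplane
  obtain ⟨c, hmed⟩ := exists_integral_Ioi_eq_integral_Iic (m := fun s => ∫ x, f (s, x))
    (by rw [Measure.volume_eq_prod] at hfi; exact hfi.integral_prod_left)
    (by rwa [Measure.volume_eq_prod, integral_prod _ hfi] at hfpos)
  set f₁ : ℝ × (Fin n → ℝ) → ℝ := fun q => f (c + q.1, q.2) with hf₁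
  have hf₁R : RapidDensity f₁ := by simpa using hf.shear c 0 0
  have hf₁i := hf₁R.integrable volume
  have hmed₁ : ∫ q in Ioi 0 ×ˢ univ, f₁ q = ∫ q in Iic 0 ×ˢ univ, f₁ q := by
    rw [setIntegral_prod_univ_eq hf₁i, setIntegral_prod_univ_eq hf₁i]
    have e1 := (measurePreserving_add_left (volume : Measure ℝ) c).setIntegral_preimage_emb
      (measurableEmbedding_addLeft c) (fun s => ∫ x, f (s, x)) (Ioi c)
    have e2 := (measurePreserving_add_left (volume : Measure ℝ) c).setIntegral_preimage_emb
      (measurableEmbedding_addLeft c) (fun s => ∫ x, f (s, x)) (Iic c)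
    simp only [preimage_const_add_Ioi, preimage_const_add_Iic, sub_self] at e1 e2
    simp only [hf₁]
    rw [e1, e2, hmed]
  have hsi : Integrable fun q : ℝ × (Fin n → ℝ) => q.1 * f₁ q :=
    hf₁R.integrable_mul volume continuous_fst (a := 1) fun q => by
      have : |q.1| ≤ ‖q‖ := norm_fst_le q
      linarith
  have hxi : ∀ i, Integrable fun q : ℝ × (Fin n → ℝ) => q.2 i * f₁ q := fun i =>
    hf₁R.integrable_mul volume (by fun_prop) (a := 1) fun q => by
      have : |q.2 i| ≤ ‖q.2‖ := norm_le_pi_norm q.2 i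
      have := norm_snd_le q
      linarith
  set M := ∫ q in Ioi 0 ×ˢ univ, f₁ q with hM
  set A := ∫ q in Ioi 0 ×ˢ univ, q.1 * f₁ q with hA
  set B := ∫ q in Iic 0 ×ˢ univ, q.1 * f₁ q with hB
  have hop : IsOpen (Ioi (0 : ℝ) ×ˢ (univ : Set (Fin n → ℝ))) := isOpen_Ioi.prod isOpen_univ
  have hvpos : 0 < volume (Ioi (0 : ℝ) ×ˢ (univ : Set (Fin n → ℝ))) :=
    hop.measure_pos volume ⟨(1, 0), by simp⟩
  have hMpos : 0 < M := hf₁R.setIntegral_pos volume hvpos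
  have hApos : 0 < A := by
    rw [hA, setIntegral_pos_iff_support_of_nonneg_ae _ hsi.integrableOn]
    · refine hvpos.trans_le (measure_mono fun q hq => ⟨?_, hq⟩)
      exact (mul_pos hq.1 (hf₁R.pos q)).ne'
    · filter_upwards [ae_restrict_mem hop.measurableSet] with q hq
      exact (mul_pos hq.1 (hf₁R.pos q)).le
  have hBneg : B ≤ 0 := setIntegral_nonpos (measurableSet_Iic.prod .univ) fun q hq =>
    mul_nonpos_of_nonpos_of_nonneg hq.1 (hf₁R.pos q).le
  set X : Fin n → ℝ := fun i => ∫ q : ℝ × (Fin n → ℝ) in Ioi 0 ×ˢ univ, q.2 i * f₁ q with hX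
  set Y : Fin n → ℝ := fun i => ∫ q : ℝ × (Fin n → ℝ) in Iic 0 ×ˢ univ, q.2 i * f₁ q with hY
  set w : Fin n → ℝ := fun i => (X i - Y i) / (A - B) with hw
  set p : Fin n → ℝ := fun i => (X i - w i * A) / M with hp
  set f₂ : ℝ × (Fin n → ℝ) → ℝ := fun q => f₁ (q.1, p + q.2 + q.1 • w) with hf₂
  have hf₂R : RapidDensity f₂ := by simpa using hf₁R.shear 0 p w
  have hf₂i := hf₂R.integrable volume
  have hhalf : ∀ S : Set ℝ, ∫ x, ∫ s in S, f₂ (s, x) = ∫ q in S ×ˢ univ, f₁ q := fun S => by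
    rw [integral_setIntegral_eq hf₂i, ← setIntegral_shear S hf₁i hf₂i]
  have hcen : ∀ S i, ∫ x : Fin n → ℝ, x i * ∫ s in S, f₂ (s, x) =
      (∫ q : ℝ × (Fin n → ℝ) in S ×ˢ univ, q.2 i * f₁ q) - p i * (∫ q in S ×ˢ univ, f₁ q) -
        w i * ∫ q in S ×ˢ univ, q.1 * f₁ q := fun S i => by
    have hx₂ : Integrable fun q : ℝ × (Fin n → ℝ) => q.2 i * f₂ q :=
      hf₂R.integrable_mul volume (by fun_prop) (a := 1) fun q => by
        have : |q.2 i| ≤ ‖q.2‖ := norm_le_pi_norm q.2 i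
        have := norm_snd_le q
        linarith
    have hF := ((hxi i).sub (hf₁i.const_mul (p i))).sub (hsi.const_mul (w i))
    have e1 := setIntegral_shear (p := p) (w := w) S hF (by
      refine hx₂.congr (ae_of_all _ fun q => ?_)
      simp only [Pi.sub_apply, hf₂, Pi.add_apply, Pi.smul_apply, smul_eq_mul]
      ring)
    simp only [← integral_const_mul]
    rw [integral_setIntegral_eq hx₂]
    rw [integral_sub' ((hxi i).sub (hf₁i.const_mul (p i))).integrableOn
      (hsi.const_mul (w i)).integrableOn, integral_sub' (hxi i).integrableOn
      (hf₁i.const_mul (p i)).integrableOn] at e1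
    rw [← e1]
    congr 1 with q
    simp only [Pi.sub_apply, hf₂, Pi.add_apply, Pi.smul_apply, smul_eq_mul]
    ring
  -- tilting and shearing the second function
  set z : ℝ × (Fin n → ℝ) →L[ℝ] ℝ := LinearMap.toContinuousLinearMap
    (c • LinearMap.fst ℝ ℝ (Fin n → ℝ) +
      (dotProductBilin ℝ ℝ p).comp (LinearMap.snd ℝ ℝ (Fin n → ℝ))) with hz
  have hzr : ∀ r, z r = c * r.1 + p ⬝ᵥ r.2 := fun r => by simp [hz, dotProductBilin]
  have hzi : Integrable fun r : ℝ × (Fin n → ℝ) => r.1 * g r :=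
    hg.integrable_mul volume continuous_fst (a := 1) fun q => by
      have : |q.1| ≤ ‖q‖ := norm_fst_le q
      linarith
  have hyi : ∀ i, Integrable fun r : ℝ × (Fin n → ℝ) => r.2 i * g r := fun i =>
    hg.integrable_mul volume (by fun_prop) (a := 1) fun q => by
      have : |q.2 i| ≤ ‖q.2‖ := norm_le_pi_norm q.2 i
      have := norm_snd_le q
      linarith
  have hzc : ∫ r, z r * g r = 0 := by
    have e1 : ∀ r : ℝ × (Fin n → ℝ), z r * g r =
        c * (r.1 * g r) + ∑ i, p i * (r.2 i * g r) := fun r => by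
      rw [hzr, dotProduct, add_mul, Finset.sum_mul]
      congr 1
      · ring
      · exact Finset.sum_congr rfl fun i _ => by ring
    simp only [e1]
    rw [integral_add (hzi.const_mul c)
      (integrable_finsetSum _ fun i _ => (hyi i).const_mul (p i)), integral_const_mul, hc₀,
      integral_finsetSum _ fun i _ => (hyi i).const_mul (p i)]
    simp [integral_const_mul, hc]
  obtain ⟨htilt, htilt_eq⟩ := hg.integral_le_integral_mul_exp z hzc
  have hgzR : RapidDensity fun r => g r * Real.exp (z r) :=
    hg.mul_exp z.continuous (norm_nonneg z) fun x => (le_abs_self _).trans (z.le_opNorm x)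
  have hg₂R := hgzR.shear_fst w
  have hg₂I := integral_shear_fst (hgzR.integrable volume) (hg₂R.integrable volume)
  have hf₂I : ∫ q, f₂ q = ∫ q, f q := by
    have e1 := setIntegral_shear univ hf₁i hf₂i
    have e2 := (measurePreserving_add_left (volume : Measure (ℝ × (Fin n → ℝ)))
      (c, 0)).integral_comp (measurableEmbedding_addLeft _) f
    rw [univ_prod_univ, setIntegral_univ, setIntegral_univ] at e1
    rw [← e2]
    refine e1.trans ?_
    congr 1 with q
    simp [hf₁, Prod.add_def]
  have key := split_space_santalo hS hf₂R hg₂R (fun q r => by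
      have e1 := h (c + q.1, p + q.2 + q.1 • w) (r.1 - w ⬝ᵥ r.2, r.2)
      simp only [hf₂, hf₁]
      rw [← mul_assoc]
      refine (mul_le_mul_of_nonneg_right e1 (Real.exp_pos _).le).trans_eq ?_
      rw [← Real.exp_add, hzr]
      congr 1
      simp only [add_dotProduct, smul_dotProduct, smul_eq_mul]
      ring)
    (by rw [hhalf, hhalf]; exact hmed₁)
    (fun i => by
      rw [hcen]
      have : A - B ≠ 0 := by linarith
      change X i - p i * M - w i * A = 0
      simp only [hp]
      field_simp
      ring)
    (fun i => by
      rw [hcen, ← hmed₁]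
      have : A - B ≠ 0 := by linarith
      change Y i - p i * M - w i * B = 0
      simp only [hp, hw]
      field_simp
      ring)
  rw [hg₂I, hf₂I] at key
  have hle := mul_le_mul_of_nonneg_left htilt hfpos.le
  refine ⟨hle.trans key.1, fun heq => ?_⟩
  have hz0 : z = 0 := htilt_eq (mul_left_cancel₀ hfpos.ne' (by linarith [key.1]))
  have hc0 : c = 0 := by
    have := hzr (1, 0)
    simpa [hz0, eq_comm] using this
  have hp0 : p = 0 := by
    have := hzr (0, p)
    simp only [hz0, zero_apply, mul_zero, zero_add] at this
    exact dotProduct_self_eq_zero.1 (by simpa using this.symm)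
  simp only [hz0, zero_apply, Real.exp_zero, mul_one] at key
  obtain ⟨P, R, a, l, ha, hl, hPR, hfe, hge⟩ := key.2 heq
  refine ⟨P, R, w, a, l, ha, hl, hPR, fun s x => ?_, fun t y => ?_⟩
  · rw [← hfe]
    simp [hf₂, hf₁, hc0, hp0]
  · rw [← hge]
    simp

lemma cons_dotProduct_cons_eq {n : ℕ} (s t : ℝ) (x y : Fin n → ℝ) :
    (Fin.cons s x : Fin (n + 1) → ℝ) ⬝ᵥ (Fin.cons t y : Fin (n + 1) → ℝ) = s * t + x ⬝ᵥ y := by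
  simp [dotProduct, Fin.sum_univ_succ]

lemma RapidDensity.comp_cons {n : ℕ} {f : (Fin (n + 1) → ℝ) → ℝ} (hf : RapidDensity f) :
    RapidDensity fun q : ℝ × (Fin n → ℝ) => f (Fin.cons q.1 q.2) := by
  refine hf.comp (T := fun q : ℝ × (Fin n → ℝ) => (Fin.cons q.1 q.2 : Fin (n + 1) → ℝ))
    (by fun_prop) (K := 1) (M := 0) zero_le_one fun q => ?_
  rw [Prod.norm_def, one_mul, add_zero]
  refine max_le ?_ ((pi_norm_le_iff_of_nonneg (norm_nonneg _)).2 fun i => ?_)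
  · simpa using norm_le_pi_norm (Fin.cons q.1 q.2 : Fin (n + 1) → ℝ) 0
  · simpa using norm_le_pi_norm (Fin.cons q.1 q.2 : Fin (n + 1) → ℝ) i.succ

lemma integral_comp_cons {n : ℕ} (F : (Fin (n + 1) → ℝ) → ℝ) :
    ∫ q : ℝ × (Fin n → ℝ), F (Fin.cons q.1 q.2) = ∫ x, F x := by
  have h := (volume_preserving_piFinSuccAbove (fun _ : Fin (n + 1) => ℝ) 0).symm
  rw [← h.integral_comp' F]
  congr 1 with q
  congr 1
  exact (Fin.insertNth_zero' q.1 q.2).symm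

lemma isDualGaussianPair_of_sheared {n : ℕ} {f g : (Fin (n + 1) → ℝ) → ℝ}
    {P R : (Fin n → ℝ) →ₗ[ℝ] (Fin n → ℝ)} {w : Fin n → ℝ} {a l : ℝ} (ha : 0 < a) (hl : 0 < l)
    (hPR : ∀ x y, P x ⬝ᵥ R y = x ⬝ᵥ y)
    (hf : ∀ s x, f (Fin.cons s x) = a * Real.exp (-(l * s ^ 2 / 2)) *
      Real.exp (-(P (x - s • w) ⬝ᵥ P (x - s • w) / 2)))
    (hg : ∀ t y, g (Fin.cons t y) = a⁻¹ * Real.exp (-((t + w ⬝ᵥ y) ^ 2 / (2 * l))) *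
      Real.exp (-(R y ⬝ᵥ R y / 2))) : IsDualGaussianPair f g := by
  have hsl : √l * √l = l := Real.mul_self_sqrt hl.le
  have hsl0 : √l ≠ 0 := (Real.sqrt_pos.2 hl).ne'
  let P' : (Fin (n + 1) → ℝ) →ₗ[ℝ] (Fin (n + 1) → ℝ) :=
    { toFun := fun X => Fin.cons (√l * X 0) (P (Fin.tail X - X 0 • w))
      map_add' := fun X Y => by
        have : Fin.tail (X + Y) - (X + Y) 0 • w =
            (Fin.tail X - X 0 • w) + (Fin.tail Y - Y 0 • w) := by
          ext i; simp [Fin.tail]; ring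
        rw [this, map_add]
        ext i
        refine Fin.cases ?_ (fun i => ?_) i
        · simp; ring
        · simp
      map_smul' := fun c X => by
        have : Fin.tail (c • X) - (c • X) 0 • w = c • (Fin.tail X - X 0 • w) := by
          ext i; simp [Fin.tail]; ring
        rw [this, map_smul]
        ext i
        refine Fin.cases ?_ (fun i => ?_) i
        · simp; ring
        · simp }
  let R' : (Fin (n + 1) → ℝ) →ₗ[ℝ] (Fin (n + 1) → ℝ) :=
    { toFun := fun Y => Fin.cons ((Y 0 + w ⬝ᵥ Fin.tail Y) / √l) (R (Fin.tail Y))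
      map_add' := fun X Y => by
        have : Fin.tail (X + Y) = Fin.tail X + Fin.tail Y := rfl
        rw [this, map_add, dotProduct_add]
        ext i
        refine Fin.cases ?_ (fun i => ?_) i
        · simp; ring
        · simp
      map_smul' := fun c X => by
        have : Fin.tail (c • X) = c • Fin.tail X := rfl
        rw [this, map_smul, dotProduct_smul]
        ext i
        refine Fin.cases ?_ (fun i => ?_) i
        · simp; ring
        · simp }
  have hP' : ∀ s x, P' (Fin.cons s x) = Fin.cons (√l * s) (P (x - s • w)) := fun s x => by
    simp [P']
  have hR' : ∀ t y, R' (Fin.cons t y) = Fin.cons ((t + w ⬝ᵥ y) / √l) (R y) := fun t y => by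
    simp [R']
  refine ⟨P', R', a, ha, fun X Y => ?_, fun X => ?_, fun Y => ?_⟩
  · rw [← Fin.cons_self_tail X, ← Fin.cons_self_tail Y, hP', hR', cons_dotProduct_cons_eq,
      cons_dotProduct_cons_eq, hPR, sub_dotProduct, smul_dotProduct, smul_eq_mul]
    field_simp
    ring
  · rw [← Fin.cons_self_tail X, hf, hP', cons_dotProduct_cons_eq, mul_assoc, ← Real.exp_add]
    congr 2
    linear_combination (X 0 ^ 2 / 2) * hsl
  · rw [← Fin.cons_self_tail Y, hg, hR', cons_dotProduct_cons_eq, mul_assoc, ← Real.exp_add,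
      div_mul_div_comm, hsl]
    congr 2
    field_simp
    ring

theorem functionalSantalo (n : ℕ) : FunctionalSantalo n := by
  induction n with
  | zero =>
    intro f g hf hg h _
    have h0 : f 0 * g 0 ≤ 1 := by simpa using h 0 0
    have hi : ∀ u : (Fin 0 → ℝ) → ℝ, ∫ x, u x = u 0 := fun u => by
      have hv : volume.real (univ : Set (Fin 0 → ℝ)) = 1 := by
        rw [measureReal_def, ← pi_univ univ, volume_pi_pi]
        simp
      rw [integral_unique, hv, one_smul]
      exact congrArg u (Subsingleton.elim _ _)
    rw [hi, hi, pow_zero]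
    refine ⟨h0, fun heq => ⟨0, 0, f 0, hf.pos 0, fun x y => by simp, fun x => ?_, fun y => ?_⟩⟩
    · simp [Subsingleton.elim x 0]
    · rw [Subsingleton.elim y 0, eq_inv_of_mul_eq_one_right heq]
      simp
  | succ n ih =>
    intro f g hf hg h hc
    have key := sheared_santalo ih hg.comp_cons hf.comp_cons (fun q r => by
        rw [mul_comm]
        refine (h _ _).trans_eq ?_
        rw [cons_dotProduct_cons_eq, dotProduct_comm, mul_comm r.1])
      (by rw [← hc 0, ← integral_comp_cons]; simp)
      (fun i => by rw [← hc i.succ, ← integral_comp_cons]; simp)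
    rw [integral_comp_cons, integral_comp_cons, mul_comm] at key
    refine ⟨key.1, fun heq => ?_⟩
    obtain ⟨P, R, w, a, l, ha, hl, hPR, hge, hfe⟩ := key.2 heq
    exact (isDualGaussianPair_of_sheared ha hl hPR hge hfe).symm

/-! ### Radial integration of functions of a gauge -/

section LayerCake

variable {E : Type*} [NormedAddCommGroup E] [NormedSpace ℝ E] [FiniteDimensional ℝ E]
  [MeasurableSpace E] [BorelSpace E] (μ : Measure E) [μ.IsAddHaarMeasure]

lemma lintegral_comp_inv_smul (G : E → ℝ≥0∞) (hG : Measurable G) {r : ℝ} (hr : 0 < r) :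
    ∫⁻ x, G (r⁻¹ • x) ∂μ = ENNReal.ofReal (r ^ Module.finrank ℝ E) * ∫⁻ x, G x ∂μ := by
  rw [← lintegral_map hG (measurable_const_smul r⁻¹),
    Measure.map_addHaar_smul μ (inv_ne_zero hr.ne'), lintegral_smul_measure, inv_pow, inv_inv,
    abs_of_nonneg (by positivity), smul_eq_mul]

variable {N : E → ℝ} {q : E → ℝ≥0∞} {d : ℕ}

lemma setLIntegral_sublevel (hNc : Continuous N) (hNh : ∀ r > 0, ∀ x, N (r • x) = r * N x)
    (hq : Measurable q) (hqh : ∀ r > 0, ∀ x, q (r • x) = ENNReal.ofReal (r ^ d) * q x)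
    {r : ℝ} (hr : 0 < r) :
    ∫⁻ x in {x | N x ≤ r}, q x ∂μ =
      ENNReal.ofReal (r ^ (Module.finrank ℝ E + d)) * ∫⁻ x in {x | N x ≤ 1}, q x ∂μ := by
  have hm : ∀ t, MeasurableSet {x | N x ≤ t} := fun t => measurableSet_le hNc.measurable
    measurable_const
  rw [← lintegral_indicator (hm r), ← lintegral_indicator (hm 1), pow_add,
    ENNReal.ofReal_mul (by positivity), mul_comm (ENNReal.ofReal (r ^ Module.finrank ℝ E)),
    mul_assoc, ← lintegral_comp_inv_smul μ _ (hq.indicator (hm 1)) hr,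
    ← lintegral_const_mul' _ _ ENNReal.ofReal_ne_top]
  congr 1 with x
  have hx : N (r⁻¹ • x) ≤ 1 ↔ N x ≤ r := by
    rw [hNh _ (inv_pos.2 hr), inv_mul_le_iff₀ hr, mul_one]
  by_cases h : N x ≤ r
  · rw [indicator_of_mem (by exact h), indicator_of_mem (by exact hx.2 h), ← hqh r hr,
      smul_inv_smul₀ hr.ne']
  · rw [indicator_of_notMem (by exact h), indicator_of_notMem (by exact mt hx.1 h), mul_zero]

lemma lintegral_mul_lintegral_Ioi (hNc : Continuous N) (hN0 : ∀ x, 0 ≤ N x)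
    (hNh : ∀ r > 0, ∀ x, N (r • x) = r * N x)
    (hq : Measurable q) (hqh : ∀ r > 0, ∀ x, q (r • x) = ENNReal.ofReal (r ^ d) * q x)
    {k φ : ℝ → ℝ≥0∞} (hk : Measurable k) (hφ : ∀ t ≥ 0, ∫⁻ r in Ioi t, k r = φ t) :
    ∫⁻ x, q x * φ (N x) ∂μ =
      (∫⁻ r in Ioi 0, k r * ENNReal.ofReal (r ^ (Module.finrank ℝ E + d))) *
        ∫⁻ x in {x | N x ≤ 1}, q x ∂μ := by
  have h1 : ∀ x, q x * φ (N x) =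
      ∫⁻ r in Ioi 0, {p : E × ℝ | N p.1 ≤ p.2}.indicator (fun p => q p.1 * k p.2) (x, r) := by
    intro x
    have : ∀ r, {p : E × ℝ | N p.1 ≤ p.2}.indicator (fun p => q p.1 * k p.2) (x, r) =
        (Ici (N x)).indicator (fun r => q x * k r) r := fun r => rfl
    simp only [this]
    rw [lintegral_indicator measurableSet_Ici, lintegral_const_mul _ hk, ← hφ _ (hN0 x),
      Measure.restrict_restrict measurableSet_Ici]
    congr 1
    refine setLIntegral_congr ?_
    have h2 : (Ici (N x) ∩ Ioi 0 : Set ℝ) =ᵐ[volume] (Ioi (N x) ∩ Ioi 0 : Set ℝ) :=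
      Ioi_ae_eq_Ici.symm.inter (ae_eq_refl _)
    rw [Ioi_inter_Ioi, sup_of_le_left (hN0 x)] at h2
    exact h2.symm
  have hms : MeasurableSet {p : E × ℝ | N p.1 ≤ p.2} :=
    measurableSet_le (hNc.measurable.comp measurable_fst) measurable_snd
  simp only [h1]
  rw [lintegral_lintegral_swap (f := fun x r =>
    {p : E × ℝ | N p.1 ≤ p.2}.indicator (fun p => q p.1 * k p.2) (x, r))
    (((hq.comp measurable_fst).mul (hk.comp measurable_snd)).indicator hms).aemeasurable,
    ← lintegral_mul_const _ (f := fun r => k r * ENNReal.ofReal (r ^ (Module.finrank ℝ E + d)))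
      (hk.mul (by fun_prop))]
  refine setLIntegral_congr_fun measurableSet_Ioi fun r hr => ?_
  have : ∀ x, {p : E × ℝ | N p.1 ≤ p.2}.indicator (fun p => q p.1 * k p.2) (x, r) =
      {x | N x ≤ r}.indicator (fun x => k r * q x) x := fun x => by
    simp only [indicator, mem_ofPred_eq, mul_comm]
  simp only [this]
  rw [lintegral_indicator (measurableSet_le hNc.measurable measurable_const),
    lintegral_const_mul _ hq, setLIntegral_sublevel μ hNc hNh hq hqh hr, mul_assoc]

end LayerCake

lemma lintegral_Ioi_ofReal_neg_deriv {u u' : ℝ → ℝ} {t : ℝ} (hu : ∀ x, HasDerivAt u (-u' x) x)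
    (h0 : ∀ x ≥ t, 0 ≤ u' x) (hl : Tendsto u atTop (𝓝 0)) :
    ∫⁻ r in Ioi t, ENNReal.ofReal (u' r) = ENNReal.ofReal (u t) := by
  have hd : ∀ x, HasDerivAt (-u) (u' x) x := fun x => by simpa using (hu x).neg
  have hl' : Tendsto (-u) atTop (𝓝 0) := by
    have := hl.neg
    rwa [neg_zero] at this
  rw [← ofReal_integral_eq_lintegral_ofReal
    (integrableOn_Ioi_deriv_of_nonneg' (fun x _ => hd x) (fun x hx => h0 x (le_of_lt hx)) hl')
    ((ae_restrict_mem measurableSet_Ioi).mono fun x hx => h0 x (le_of_lt hx)),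
    integral_Ioi_of_hasDerivAt_of_nonneg' (fun x _ => hd x) (fun x hx => h0 x (le_of_lt hx)) hl']
  simp

lemma lintegral_Ioi_mul_exp_neg_sq {t : ℝ} (ht : 0 ≤ t) :
    ∫⁻ r in Ioi t, ENNReal.ofReal (r * Real.exp (-(r ^ 2 / 2))) =
      ENNReal.ofReal (Real.exp (-(t ^ 2 / 2))) := by
  refine lintegral_Ioi_ofReal_neg_deriv (u := fun t => Real.exp (-(t ^ 2 / 2)))
    (u' := fun r => r * Real.exp (-(r ^ 2 / 2))) (fun x => ?_)
    (fun x hx => mul_nonneg (ht.trans hx) (Real.exp_pos _).le) ?_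
  · have h := (((hasDerivAt_pow 2 x).div_const 2).fun_neg).exp
    convert h using 1
    simp; ring
  · refine Real.tendsto_exp_neg_atTop_nhds_zero.comp ?_
    exact (tendsto_pow_atTop two_ne_zero).atTop_div_const two_pos

lemma lintegral_Ioi_exp_neg (t : ℝ) :
    ∫⁻ r in Ioi t, ENNReal.ofReal (Real.exp (-r)) = ENNReal.ofReal (Real.exp (-t)) :=
  lintegral_Ioi_ofReal_neg_deriv (fun x => by simpa using (hasDerivAt_neg x).exp)
    (fun x _ => (Real.exp_pos _).le) Real.tendsto_exp_neg_atTop_nhds_zero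

/-! ### Gauges of convex bodies and their polars -/

section Gauge

variable {n : ℕ} {K : Set (EuclideanSpace ℝ (Fin n))}

lemma polarSet_eq_iInter (K : Set (EuclideanSpace ℝ (Fin n))) :
    polarSet K = ⋂ x ∈ K, {y | ⟪x, y⟫_ℝ ≤ 1} := by
  ext y; simp [polarSet]

lemma IsConvexBody.polarSet (hK : IsConvexBody K) (h0 : K ∈ 𝓝 0) :
    IsConvexBody (polarSet K) ∧ polarSet K ∈ 𝓝 0 := by
  obtain ⟨r, hr, hrK⟩ := Metric.mem_nhds_iff.1 h0
  obtain ⟨R, hR, hKR⟩ := hK.isCompact.isBounded.subset_closedBall_lt 0 0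
  have hnhds : _root_.polarSet K ∈ 𝓝 0 := by
    refine Filter.mem_of_superset (Metric.ball_mem_nhds 0 (inv_pos.2 hR)) fun y hy x hx => ?_
    have h1 := hKR hx
    rw [mem_closedBall_zero_iff] at h1
    rw [mem_ball_zero_iff] at hy
    calc ⟪x, y⟫_ℝ ≤ ‖x‖ * ‖y‖ := real_inner_le_norm x y
      _ ≤ R * R⁻¹ := by gcongr
      _ = 1 := mul_inv_cancel₀ hR.ne'
  refine ⟨⟨?_, ?_, ⟨0, mem_interior_iff_mem_nhds.2 hnhds⟩⟩, hnhds⟩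
  · rw [polarSet_eq_iInter]
    exact convex_iInter₂ fun x _ => convex_halfSpace_le (innerₛₗ ℝ x).isLinear 1
  · refine Metric.isCompact_of_isClosed_isBounded ?_ ?_
    · rw [polarSet_eq_iInter]
      exact isClosed_biInter fun x _ => isClosed_le (by fun_prop) continuous_const
    · refine (Metric.isBounded_closedBall (x := 0) (r := 2 / r)).subset fun y hy => ?_
      rw [mem_closedBall_zero_iff]
      rcases eq_or_ne y 0 with rfl | hy0
      · simp; positivity
      have hyn : 0 < ‖y‖ := norm_pos_iff.2 hy0
      have h1 := hy ((r / 2 / ‖y‖) • y) (hrK (by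
        rw [mem_ball_zero_iff, norm_smul, Real.norm_of_nonneg (by positivity),
          div_mul_cancel₀ _ hyn.ne']
        linarith))
      rw [real_inner_smul_left, real_inner_self_eq_norm_sq] at h1
      rw [le_div_iff₀ hr]
      field_simp at h1
      linarith

lemma IsConvexBody.gauge_le_one_iff (hK : IsConvexBody K) (h0 : K ∈ 𝓝 0)
    {x : EuclideanSpace ℝ (Fin n)} : gauge K x ≤ 1 ↔ x ∈ K := by
  rw [gauge_le_one_iff_mem_closure hK.convex h0, hK.isCompact.isClosed.closure_eq]

lemma gauge_smul_of_pos (K : Set (EuclideanSpace ℝ (Fin n))) (r : ℝ) (hr : 0 < r)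
    (x : EuclideanSpace ℝ (Fin n)) : gauge K (r • x) = r * gauge K x := by
  rw [gauge_smul_of_nonneg hr.le, smul_eq_mul]

lemma IsConvexBody.exists_mul_norm_le_gauge (hK : IsConvexBody K) (h0 : K ∈ 𝓝 0) :
    ∃ δ > 0, ∀ x, δ * ‖x‖ ≤ gauge K x := by
  obtain ⟨R, hR, hKR⟩ := hK.isCompact.isBounded.subset_closedBall_lt 0 0
  refine ⟨R⁻¹, inv_pos.2 hR, fun x => ?_⟩
  have := le_gauge_of_subset_closedBall (x := x) (absorbent_nhds_zero h0) hR.le hKR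
  rwa [div_eq_inv_mul] at this

lemma IsConvexBody.gauge_smul_mem (hK : IsConvexBody K) (h0 : K ∈ 𝓝 0)
    (x : EuclideanSpace ℝ (Fin n)) : ∃ u ∈ K, x = gauge K x • u := by
  rcases (gauge_nonneg x (s := K)).eq_or_lt with h | h
  · obtain ⟨δ, hδ, hle⟩ := hK.exists_mul_norm_le_gauge h0
    have h1 := hle x
    rw [← h] at h1
    have hx : x = 0 := by
      by_contra hx
      have := mul_pos hδ (norm_pos_iff.2 hx)
      linarith
    exact ⟨0, mem_of_mem_nhds h0, by simp [hx]⟩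
  · refine ⟨(gauge K x)⁻¹ • x, (hK.gauge_le_one_iff h0).1 ?_, (smul_inv_smul₀ h.ne' x).symm⟩
    rw [gauge_smul_of_pos _ _ (inv_pos.2 h), inv_mul_cancel₀ h.ne']

lemma IsConvexBody.inner_le_gauge_mul_gauge (hK : IsConvexBody K) (h0 : K ∈ 𝓝 0)
    (x y : EuclideanSpace ℝ (Fin n)) :
    ⟪x, y⟫_ℝ ≤ gauge K x * gauge (_root_.polarSet K) y := by
  obtain ⟨hP, hP0⟩ := hK.polarSet h0
  obtain ⟨u, hu, hx⟩ := hK.gauge_smul_mem h0 x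
  obtain ⟨v, hv, hy⟩ := hP.gauge_smul_mem hP0 y
  have h1 := hv u hu
  conv_lhs => rw [hx, hy, real_inner_smul_left, real_inner_smul_right, ← mul_assoc]
  exact mul_le_of_le_one_right (mul_nonneg (gauge_nonneg _) (gauge_nonneg _)) h1

lemma IsConvexBody.rapidDensity (hK : IsConvexBody K) (h0 : K ∈ 𝓝 0) :
    RapidDensity fun x => Real.exp (-(gauge K x ^ 2 / 2)) where
  cont := by have := continuous_gauge hK.convex h0; fun_prop
  pos x := Real.exp_pos _
  decay k hk := by
    obtain ⟨δ, hδ, hle⟩ := hK.exists_mul_norm_le_gauge h0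
    refine ⟨Real.exp ((k / δ) ^ 2 / 2), Real.exp_pos _, fun x => ?_⟩
    rw [← Real.exp_add]
    gcongr
    have h1 : k * ‖x‖ ≤ k / δ * gauge K x := by
      calc k * ‖x‖ = k / δ * (δ * ‖x‖) := by field_simp
        _ ≤ _ := by gcongr; exact hle x
    nlinarith [sq_nonneg (k / δ - gauge K x)]

/-- The ratio between the Gaussian mass attached to a gauge and the volume of its body. -/
def gaussianVolumeRatio (n : ℕ) : ℝ≥0∞ :=
  ∫⁻ r in Ioi 0, ENNReal.ofReal (r * Real.exp (-(r ^ 2 / 2))) * ENNReal.ofReal (r ^ n)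

lemma IsConvexBody.ofReal_integral_exp_gauge (hK : IsConvexBody K) (h0 : K ∈ 𝓝 0) :
    ENNReal.ofReal (∫ x, Real.exp (-(gauge K x ^ 2 / 2))) =
      gaussianVolumeRatio n * volume K := by
  rw [ofReal_integral_eq_lintegral_ofReal ((hK.rapidDensity h0).integrable volume)
    (ae_of_all _ fun x => (Real.exp_pos _).le)]
  have h := lintegral_mul_lintegral_Ioi volume (continuous_gauge hK.convex h0)
    (fun x => gauge_nonneg x) (gauge_smul_of_pos K) (q := fun _ => 1) (d := 0) measurable_const
    (by simp) (k := fun r => ENNReal.ofReal (r * Real.exp (-(r ^ 2 / 2)))) (by fun_prop)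
    (φ := fun t => ENNReal.ofReal (Real.exp (-(t ^ 2 / 2))))
    (fun t ht => lintegral_Ioi_mul_exp_neg_sq ht)
  simpa [hK.gauge_le_one_iff h0, gaussianVolumeRatio] using h

lemma IsConvexBody.integral_coord_mul_exp_gauge (hK : IsConvexBody K) (h0 : K ∈ 𝓝 0) (i : Fin n)
    (hc : ∫ x in K, x i = 0) : ∫ x, x i * Real.exp (-(gauge K x ^ 2 / 2)) = 0 := by
  have hcont : Continuous fun x : EuclideanSpace ℝ (Fin n) => x i := by fun_prop
  have hlay : ∀ σ : ℝ, ∫⁻ x : EuclideanSpace ℝ (Fin n),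
      ENNReal.ofReal (σ * (x i * Real.exp (-(gauge K x ^ 2 / 2)))) =
      (∫⁻ r in Ioi 0, ENNReal.ofReal (r * Real.exp (-(r ^ 2 / 2))) *
        ENNReal.ofReal (r ^ (Module.finrank ℝ (EuclideanSpace ℝ (Fin n)) + 1))) *
        ∫⁻ x in K, ENNReal.ofReal (σ * x i) := fun σ => by
    have h := lintegral_mul_lintegral_Ioi (volume : Measure (EuclideanSpace ℝ (Fin n)))
      (continuous_gauge hK.convex h0)
      (fun x => gauge_nonneg x) (gauge_smul_of_pos K) (q := fun x => ENNReal.ofReal (σ * x i))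
      (d := 1) (by fun_prop)
      (fun r hr x => by
        rw [← ENNReal.ofReal_mul (by positivity)]
        congr 1
        simp; ring)
      (k := fun r => ENNReal.ofReal (r * Real.exp (-(r ^ 2 / 2)))) (by fun_prop)
      (φ := fun t => ENNReal.ofReal (Real.exp (-(t ^ 2 / 2))))
      (fun t ht => lintegral_Ioi_mul_exp_neg_sq ht)
    have hs : {x | gauge K x ≤ 1} = K := by ext x; exact hK.gauge_le_one_iff h0
    rw [hs] at h
    rw [← h]
    congr 1 with x
    rw [← ENNReal.ofReal_mul' (Real.exp_pos _).le, mul_assoc]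
  have hint : IntegrableOn (fun x : EuclideanSpace ℝ (Fin n) => x i) K :=
    hcont.continuousOn.integrableOn_compact hK.isCompact
  have hbal : ∫⁻ x in K, ENNReal.ofReal (x i) = ∫⁻ x in K, ENNReal.ofReal (-x i) := by
    rw [integral_eq_lintegral_pos_part_sub_lintegral_neg_part hint, sub_eq_zero] at hc
    refine (ENNReal.toReal_eq_toReal_iff' ?_ ?_).1 hc
    · exact hint.lintegral_lt_top.ne
    · exact hint.neg.lintegral_lt_top.ne
  have hi : Integrable fun x : EuclideanSpace ℝ (Fin n) =>
      x i * Real.exp (-(gauge K x ^ 2 / 2)) :=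
    (hK.rapidDensity h0).integrable_mul volume hcont (a := 1) fun x => by
      have : ‖x i‖ ≤ ‖x‖ := PiLp.norm_apply_le x i
      rw [Real.norm_eq_abs] at this
      linarith
  rw [integral_eq_lintegral_pos_part_sub_lintegral_neg_part hi]
  have h1 := hlay 1
  have h2 := hlay (-1)
  simp only [one_mul, neg_one_mul] at h1 h2
  rw [h1, h2, hbal, sub_self]

end Gauge

section Transfer

variable {n : ℕ}

lemma integral_comp_toLp (F : EuclideanSpace ℝ (Fin n) → ℝ) :
    ∫ x : Fin n → ℝ, F (WithLp.toLp 2 x) = ∫ x, F x :=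
  ((EuclideanSpace.volume_preserving_symm_measurableEquiv_toLp (Fin n)).symm).integral_comp' F

lemma RapidDensity.comp_toLp {f : EuclideanSpace ℝ (Fin n) → ℝ} (hf : RapidDensity f) :
    RapidDensity fun x : Fin n → ℝ => f (WithLp.toLp 2 x) := by
  refine hf.comp (T := fun x : Fin n → ℝ => (WithLp.toLp 2 x : EuclideanSpace ℝ (Fin n)))
    (PiLp.continuous_toLp 2 _) (K := 1) (M := 0) zero_le_one fun x => ?_
  rw [one_mul, add_zero]
  exact (pi_norm_le_iff_of_nonneg (norm_nonneg _)).2 fun i =>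
    PiLp.norm_apply_le (WithLp.toLp 2 x : EuclideanSpace ℝ (Fin n)) i

lemma inner_eq_dotProduct (x y : EuclideanSpace ℝ (Fin n)) :
    ⟪x, y⟫_ℝ = x.ofLp ⬝ᵥ y.ofLp := by
  rw [EuclideanSpace.inner_eq_star_dotProduct, dotProduct_comm]
  simp

/-- The Gaussian mass of the unit ball, in terms of its volume. -/
lemma gaussianVolumeRatio_mul_volume_ball_sq (n : ℕ) :
    (gaussianVolumeRatio n * volume (Metric.closedBall (0 : EuclideanSpace ℝ (Fin n)) 1)) ^ 2 =
      ENNReal.ofReal ((2 * Real.pi) ^ n) := by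
  have hB : IsConvexBody (Metric.closedBall (0 : EuclideanSpace ℝ (Fin n)) 1) :=
    ⟨convex_closedBall 0 1, isCompact_closedBall 0 1,
      ⟨0, mem_interior_iff_mem_nhds.2 (Metric.closedBall_mem_nhds 0 one_pos)⟩⟩
  rw [← hB.ofReal_integral_exp_gauge (Metric.closedBall_mem_nhds 0 one_pos),
    ← ENNReal.ofReal_pow (integral_nonneg fun x => (Real.exp_pos _).le)]
  have h := GaussianFourier.integral_rexp_neg_mul_sq_norm (V := EuclideanSpace ℝ (Fin n))
    (b := 1 / 2) (by norm_num)
  have e : ∀ x : EuclideanSpace ℝ (Fin n),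
      Real.exp (-(gauge (Metric.closedBall 0 1) x ^ 2 / 2)) = Real.exp (-(1 / 2) * ‖x‖ ^ 2) :=
    fun x => by rw [gauge_closedBall zero_le_one, div_one]; ring_nf
  simp only [e, h]
  congr 1
  rw [← Real.rpow_natCast, ← Real.rpow_mul (by positivity), finrank_euclideanSpace_fin]
  have : (n : ℝ) / 2 * (2 : ℕ) = n := by push_cast; ring
  rw [this, Real.rpow_natCast]
  congr 1
  ring

lemma volume_unit_closedBall_ne_zero (n : ℕ) :
    volume (Metric.closedBall (0 : EuclideanSpace ℝ (Fin n)) 1) ≠ 0 :=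
  (Metric.measure_closedBall_pos volume 0 one_pos).ne'

lemma gaussianVolumeRatio_ne_zero_and_ne_top (n : ℕ) :
    gaussianVolumeRatio n ≠ 0 ∧ gaussianVolumeRatio n ≠ ⊤ := by
  have h := gaussianVolumeRatio_mul_volume_ball_sq n
  constructor <;> intro h0 <;> rw [h0] at h
  · have : (0 : ℝ) < (2 * Real.pi) ^ n := by positivity
    simp [eq_comm, this.not_ge] at h
  · rw [ENNReal.top_mul (volume_unit_closedBall_ne_zero n)] at h
    simp [eq_comm] at h

/-- The Blaschke-Santaló inequality for a convex body whose barycenter is the origin. -/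
theorem IsConvexBody.volume_mul_volume_polarSet_le {K : Set (EuclideanSpace ℝ (Fin n))}
    (hK : IsConvexBody K) (h0 : K ∈ 𝓝 0) (hc : ∀ i, ∫ x in K, x i = 0) :
    volume K * volume (_root_.polarSet K) ≤
        volume (Metric.closedBall (0 : EuclideanSpace ℝ (Fin n)) 1) ^ 2 ∧
      (volume K * volume (_root_.polarSet K) =
        volume (Metric.closedBall (0 : EuclideanSpace ℝ (Fin n)) 1) ^ 2 →
      ∃ L : EuclideanSpace ℝ (Fin n) ≃ₗ[ℝ] EuclideanSpace ℝ (Fin n),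
        K = L '' Metric.closedBall 0 1) := by
  obtain ⟨hP, hP0⟩ := hK.polarSet h0
  obtain ⟨hc0, hct⟩ := gaussianVolumeRatio_ne_zero_and_ne_top n
  have hcc0 := pow_ne_zero 2 hc0
  have hcct := ENNReal.pow_ne_top (n := 2) hct
  have key := functionalSantalo n _ _ (hK.rapidDensity h0).comp_toLp (hP.rapidDensity hP0).comp_toLp
    (fun x y => by
      rw [← Real.exp_add]
      gcongr
      have h1 := hK.inner_le_gauge_mul_gauge h0 (WithLp.toLp 2 x) (WithLp.toLp 2 y)
      rw [inner_eq_dotProduct] at h1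
      simp only at h1
      nlinarith [sq_nonneg (gauge K (WithLp.toLp 2 x) -
        gauge (_root_.polarSet K) (WithLp.toLp 2 y))])
    (fun i => by
      rw [← hK.integral_coord_mul_exp_gauge h0 i (hc i), ← integral_comp_toLp])
  rw [integral_comp_toLp fun x => Real.exp (-(gauge K x ^ 2 / 2)),
    integral_comp_toLp fun x => Real.exp (-(gauge (_root_.polarSet K) x ^ 2 / 2))] at key
  set I := ∫ x, Real.exp (-(gauge K x ^ 2 / 2)) with hI
  set J := ∫ x, Real.exp (-(gauge (_root_.polarSet K) x ^ 2 / 2)) with hJ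
  have hI0 : 0 ≤ I := integral_nonneg fun x => (Real.exp_pos _).le
  have hJ0 : 0 ≤ J := integral_nonneg fun x => (Real.exp_pos _).le
  have hIJ : ENNReal.ofReal (I * J) =
      gaussianVolumeRatio n ^ 2 * (volume K * volume (_root_.polarSet K)) := by
    rw [ENNReal.ofReal_mul hI0, hI, hJ, hK.ofReal_integral_exp_gauge h0,
      hP.ofReal_integral_exp_gauge hP0]
    ring
  have hB := gaussianVolumeRatio_mul_volume_ball_sq n
  rw [mul_pow] at hB
  refine ⟨?_, fun heq => ?_⟩
  · rw [← ENNReal.mul_le_mul_iff_right hcc0 hcct, ← hIJ, hB]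
    exact ENNReal.ofReal_le_ofReal key.1
  · rw [heq, hB, ENNReal.ofReal_eq_ofReal_iff (by positivity) (by positivity)] at hIJ
    obtain ⟨P, R, a, ha, hPR, hf, -⟩ := key.2 hIJ
    have ha1 : a = 1 := by
      have := hf 0
      simpa [eq_comm] using this
    subst ha1
    have hg : ∀ x, gauge K (WithLp.toLp 2 x) ^ 2 = P x ⬝ᵥ P x := fun x => by
      have := hf x
      rw [one_mul, Real.exp_eq_exp] at this
      linarith
    let Q : EuclideanSpace ℝ (Fin n) ≃ₗ[ℝ] EuclideanSpace ℝ (Fin n) :=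
      (WithLp.linearEquiv 2 ℝ (Fin n → ℝ)).trans
        ((LinearEquiv.ofInjectiveEndo P (injective_of_dotProduct_eq (P := R) fun x y => by
          rw [dotProduct_comm, hPR, dotProduct_comm])).trans
          (WithLp.linearEquiv 2 ℝ (Fin n → ℝ)).symm)
    have hQ : ∀ x, ‖Q x‖ = gauge K x := fun x => by
      rw [← sq_eq_sq₀ (norm_nonneg _) (gauge_nonneg _), ← real_inner_self_eq_norm_sq,
        inner_eq_dotProduct]
      exact (hg x.ofLp).symm
    refine ⟨Q.symm, ?_⟩
    rw [LinearEquiv.image_symm_eq_preimage]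
    ext x
    rw [mem_preimage, mem_closedBall_zero_iff, hQ, hK.gauge_le_one_iff h0]

end Transfer

/-! ### Barycenters, polars of translated balls, and linear images -/

section Bodies

variable {n : ℕ} {K : Set (EuclideanSpace ℝ (Fin n))}

lemma IsConvexBody.interior_ae_eq (hK : IsConvexBody K) : interior K =ᵐ[volume] K :=
  interior_ae_eq_of_null_frontier (hK.convex.addHaar_frontier volume)

lemma IsConvexBody.volume_interior_pos (hK : IsConvexBody K) : 0 < volume (interior K) :=
  isOpen_interior.measure_pos volume hK.nonempty_interior

/-- The barycenter of a convex body lies in its interior. -/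
lemma IsConvexBody.exists_barycenter_mem_interior (hK : IsConvexBody K) :
    ∃ b ∈ interior K, ∀ i, ∫ x in K, (x i - b i) = 0 := by
  have hvt : volume K ≠ ⊤ := hK.isCompact.measure_lt_top.ne
  have hv : volume.real K ≠ 0 := by
    rw [measureReal_def, ENNReal.toReal_ne_zero]
    exact ⟨(hK.volume_interior_pos.trans_le (measure_mono interior_subset)).ne', hvt⟩
  have hid : IntegrableOn (fun x : EuclideanSpace ℝ (Fin n) => x) K :=
    continuous_id.continuousOn.integrableOn_compact hK.isCompact
  set b : EuclideanSpace ℝ (Fin n) := (volume.real K)⁻¹ • ∫ x in K, x with hb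
  have hlin : ∀ l : EuclideanSpace ℝ (Fin n) →L[ℝ] ℝ, ∫ x in K, (l x - l b) = 0 := fun l => by
    rw [integral_sub (l.integrable_comp hid) (integrableOn_const hvt),
      l.integral_comp_comm hid, setIntegral_const, hb, map_smul, smul_smul,
      mul_inv_cancel₀ hv, one_smul, sub_self]
  refine ⟨b, ?_, fun i => hlin (EuclideanSpace.proj i)⟩
  by_contra hbi
  obtain ⟨l, hl⟩ := geometric_hahn_banach_open_point hK.convex.interior isOpen_interior hbi
  have h0 := hlin l
  rw [← setIntegral_congr_set hK.interior_ae_eq] at h0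
  have h1 : 0 < ∫ x in interior K, (l b - l x) := by
    rw [setIntegral_pos_iff_support_of_nonneg_ae]
    · refine hK.volume_interior_pos.trans_le (measure_mono fun x hx => ⟨?_, hx⟩)
      exact (sub_pos.2 (hl x hx)).ne'
    · filter_upwards [ae_restrict_mem isOpen_interior.measurableSet] with x hx
      exact (sub_pos.2 (hl x hx)).le
    · exact ((integrableOn_const hvt).sub (l.integrable_comp hid)).mono_set interior_subset
  have h2 : ∫ x in interior K, (l b - l x) = -∫ x in interior K, (l x - l b) := by
    rw [← integral_neg]
    simp only [neg_sub]
  rw [h2, h0, neg_zero] at h1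
  exact h1.false

lemma IsConvexBody.image_sub (hK : IsConvexBody K) {b : EuclideanSpace ℝ (Fin n)}
    (hb : b ∈ interior K) :
    IsConvexBody ((fun x => x - b) '' K) ∧ (fun x => x - b) '' K ∈ 𝓝 0 := by
  have hnhds : (fun x => x - b) '' K ∈ 𝓝 0 := by
    rw [← mem_interior_iff_mem_nhds]
    have := (Homeomorph.subRight b).image_interior K
    simp only [Homeomorph.coe_subRight] at this
    rw [← this]
    exact ⟨b, hb, sub_self b⟩
  refine ⟨⟨?_, hK.isCompact.image (by fun_prop), ⟨0, mem_interior_iff_mem_nhds.2 hnhds⟩⟩, hnhds⟩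
  have := hK.convex.translate (-b)
  simpa [sub_eq_neg_add] using this

lemma volume_image_sub (K : Set (EuclideanSpace ℝ (Fin n))) (b : EuclideanSpace ℝ (Fin n)) :
    volume ((fun x => x - b) '' K) = volume K := by
  simp only [sub_eq_add_neg, image_add_right, measure_preimage_add_right]

lemma setIntegral_image_sub (K : Set (EuclideanSpace ℝ (Fin n))) (b : EuclideanSpace ℝ (Fin n))
    (F : EuclideanSpace ℝ (Fin n) → ℝ) :
    ∫ x in (fun x => x - b) '' K, F x = ∫ x in K, F (x - b) :=
  (measurePreserving_sub_right volume b).setIntegral_image_emb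
    (measurableEmbedding_subRight b) F K

/-- Blaschke-Santaló for the polar at a suitable interior point. -/
theorem IsConvexBody.exists_volume_mul_volume_polarSet_le (hK : IsConvexBody K) :
    ∃ b ∈ interior K, volume K * volume (_root_.polarSet ((fun x => x - b) '' K)) ≤
        volume (Metric.closedBall (0 : EuclideanSpace ℝ (Fin n)) 1) ^ 2 ∧
      (volume K * volume (_root_.polarSet ((fun x => x - b) '' K)) =
        volume (Metric.closedBall (0 : EuclideanSpace ℝ (Fin n)) 1) ^ 2 →
      ∃ T : EuclideanSpace ℝ (Fin n) ≃ᵃ[ℝ] EuclideanSpace ℝ (Fin n),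
        K = T '' Metric.closedBall 0 1) := by
  obtain ⟨b, hb, hc⟩ := hK.exists_barycenter_mem_interior
  obtain ⟨hK', hK0⟩ := hK.image_sub hb
  have key := hK'.volume_mul_volume_polarSet_le hK0 fun i => by
    rw [setIntegral_image_sub K b fun x => x i]
    exact hc i
  rw [volume_image_sub] at key
  refine ⟨b, hb, key.1, fun heq => ?_⟩
  obtain ⟨L, hL⟩ := key.2 heq
  refine ⟨L.toAffineEquiv.trans (AffineEquiv.constVAdd ℝ _ b), ?_⟩
  have h1 : (fun x => b + x) '' ((fun x => x - b) '' K) = K := by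
    rw [image_image]; simp
  rw [← h1, hL, image_image]
  rfl

lemma polarSet_image_linearMap (L : EuclideanSpace ℝ (Fin n) →ₗ[ℝ] EuclideanSpace ℝ (Fin n))
    (A : Set (EuclideanSpace ℝ (Fin n))) :
    polarSet (L '' A) = L.adjoint ⁻¹' polarSet A := by
  ext y
  simp [polarSet, LinearMap.adjoint_inner_right]

lemma det_adjoint_eq (L : EuclideanSpace ℝ (Fin n) →ₗ[ℝ] EuclideanSpace ℝ (Fin n)) :
    LinearMap.det L.adjoint = LinearMap.det L := by
  rw [← LinearMap.det_toMatrix (EuclideanSpace.basisFun (Fin n) ℝ).toBasis,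
    ← LinearMap.det_toMatrix (EuclideanSpace.basisFun (Fin n) ℝ).toBasis,
    LinearMap.toMatrix_adjoint, Matrix.det_conjTranspose, star_trivial]

lemma volume_image_mul_volume_polarSet_image
    (L : EuclideanSpace ℝ (Fin n) ≃ₗ[ℝ] EuclideanSpace ℝ (Fin n))
    (A C : Set (EuclideanSpace ℝ (Fin n))) :
    volume (L '' A) * volume (polarSet (L '' C)) = volume A * volume (polarSet C) := by
  have hd : LinearMap.det (L : EuclideanSpace ℝ (Fin n) →ₗ[ℝ] EuclideanSpace ℝ (Fin n)) ≠ 0 :=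
    (LinearEquiv.isUnit_det' L).ne_zero
  have h1 := Measure.addHaar_image_linearMap volume
    (L : EuclideanSpace ℝ (Fin n) →ₗ[ℝ] EuclideanSpace ℝ (Fin n)) A
  have h2 := polarSet_image_linearMap
    (L : EuclideanSpace ℝ (Fin n) →ₗ[ℝ] EuclideanSpace ℝ (Fin n)) C
  rw [LinearEquiv.coe_coe] at h1 h2
  rw [h1, h2, Measure.addHaar_preimage_linearMap volume (by rwa [det_adjoint_eq]),
    det_adjoint_eq, mul_mul_mul_comm, ← ENNReal.ofReal_mul (abs_nonneg _), ← abs_mul,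
    mul_inv_cancel₀ hd, abs_one, ENNReal.ofReal_one, one_mul]

lemma polarSet_closedBall_sub (z : EuclideanSpace ℝ (Fin n)) :
    polarSet ((fun x => x - z) '' Metric.closedBall 0 1) = {y | ‖y‖ - ⟪z, y⟫_ℝ ≤ 1} := by
  ext y
  simp only [polarSet, mem_image, mem_closedBall_zero_iff, forall_exists_index, and_imp,
    forall_apply_eq_imp_iff₂, inner_sub_left, mem_ofPred_eq]
  refine ⟨fun h => ?_, fun h x hx => ?_⟩
  · rcases eq_or_ne y 0 with rfl | hy
    · simp
    have hy' := norm_ne_zero_iff.2 hy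
    have := h (‖y‖⁻¹ • y) (by rw [norm_smul, norm_inv, norm_norm, inv_mul_cancel₀ hy'])
    rwa [real_inner_smul_left, real_inner_self_eq_norm_sq, sq, ← mul_assoc,
      inv_mul_cancel₀ hy', one_mul] at this
  · have h1 := real_inner_le_norm x y
    nlinarith [norm_nonneg y]

lemma lintegral_exp_neg_norm_le (z : EuclideanSpace ℝ (Fin n)) :
    ∫⁻ y : EuclideanSpace ℝ (Fin n), ENNReal.ofReal (Real.exp (-‖y‖)) ≤
      ∫⁻ y : EuclideanSpace ℝ (Fin n), ENNReal.ofReal (Real.exp (-(‖y‖ - ⟪z, y⟫_ℝ))) := by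
  rw [← ENNReal.mul_le_mul_iff_right two_ne_zero ENNReal.ofNat_ne_top,
    ← lintegral_const_mul _ (by fun_prop)]
  have h := lintegral_neg_eq_self (μ := (volume : Measure (EuclideanSpace ℝ (Fin n))))
    fun y => ENNReal.ofReal (Real.exp (-(‖y‖ - ⟪z, y⟫_ℝ)))
  rw [two_mul (∫⁻ y, _)]
  nth_rewrite 1 [← h]
  rw [← lintegral_add_left (by fun_prop)]
  refine lintegral_mono fun y => ?_
  rw [two_mul, ← ENNReal.ofReal_add (Real.exp_pos _).le (Real.exp_pos _).le,
    ← ENNReal.ofReal_add (Real.exp_pos _).le (Real.exp_pos _).le]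
  refine ENNReal.ofReal_le_ofReal ?_
  rw [norm_neg, inner_neg_right, neg_sub, neg_sub, sub_eq_add_neg, sub_eq_add_neg, Real.exp_add,
    Real.exp_add]
  nlinarith [Real.add_one_le_exp ⟪z, y⟫_ℝ, Real.add_one_le_exp (-⟪z, y⟫_ℝ),
    Real.exp_pos (-‖y‖)]

lemma lintegral_exp_neg_eq {N : EuclideanSpace ℝ (Fin n) → ℝ} (hNc : Continuous N)
    (hN0 : ∀ x, 0 ≤ N x) (hNh : ∀ r > 0, ∀ x, N (r • x) = r * N x) :
    ∫⁻ x, ENNReal.ofReal (Real.exp (-N x)) =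
      (∫⁻ r in Ioi 0, ENNReal.ofReal (Real.exp (-r)) * ENNReal.ofReal (r ^ n)) *
        volume {x | N x ≤ 1} := by
  have h := lintegral_mul_lintegral_Ioi volume hNc hN0 hNh (q := fun _ => 1) (d := 0)
    measurable_const (by simp) (k := fun r => ENNReal.ofReal (Real.exp (-r))) (by fun_prop)
    (φ := fun t => ENNReal.ofReal (Real.exp (-t))) (fun t _ => lintegral_Ioi_exp_neg t)
  simpa using h

lemma volume_closedBall_le_volume_polarSet {z : EuclideanSpace ℝ (Fin n)} (hz : ‖z‖ ≤ 1) :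
    volume (Metric.closedBall (0 : EuclideanSpace ℝ (Fin n)) 1) ≤
      volume (polarSet ((fun x => x - z) '' Metric.closedBall 0 1)) := by
  rw [polarSet_closedBall_sub]
  have h1 := lintegral_exp_neg_eq (n := n) (N := fun y => ‖y‖) continuous_norm
    (fun x => norm_nonneg x) (fun r hr x => by rw [norm_smul, Real.norm_of_nonneg hr.le])
  have h2 := lintegral_exp_neg_eq (n := n) (N := fun y => ‖y‖ - ⟪z, y⟫_ℝ) (by fun_prop)
    (fun x => by
      have := real_inner_le_norm z x
      nlinarith [norm_nonneg x])
    (fun r hr x => by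
      rw [norm_smul, Real.norm_of_nonneg hr.le, real_inner_smul_right]; ring)
  have hle := lintegral_exp_neg_norm_le z
  have hball : {x : EuclideanSpace ℝ (Fin n) | ‖x‖ ≤ 1} = Metric.closedBall 0 1 := by
    ext x; simp
  rw [hball] at h1
  have hfin : ∫⁻ y : EuclideanSpace ℝ (Fin n), ENNReal.ofReal (Real.exp (-‖y‖)) ≠ ⊤ :=
    (integrable_exp_neg_norm volume).lintegral_lt_top.ne
  have hpos : ∫⁻ y : EuclideanSpace ℝ (Fin n), ENNReal.ofReal (Real.exp (-‖y‖)) ≠ 0 := by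
    intro h
    rw [lintegral_eq_zero_iff (by fun_prop)] at h
    obtain ⟨y, hy⟩ := h.exists
    simp [(Real.exp_pos _).not_ge] at hy
  rw [h1] at hfin hpos
  rw [h1, h2] at hle
  refine (ENNReal.mul_le_mul_iff_right (left_ne_zero_of_mul hpos) fun htop => ?_).1 hle
  rw [htop, ENNReal.top_mul (volume_unit_closedBall_ne_zero n)] at hfin
  exact hfin rfl

lemma le_volumeProduct_image_closedBall
    (T : EuclideanSpace ℝ (Fin n) ≃ᵃ[ℝ] EuclideanSpace ℝ (Fin n)) :
    volume (Metric.closedBall (0 : EuclideanSpace ℝ (Fin n)) 1) ^ 2 ≤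
      volumeProduct (T '' Metric.closedBall 0 1) := by
  have hsub : ∀ z, (fun x => x - T z) '' (T '' Metric.closedBall 0 1) =
      T.linear '' ((fun x => x - z) '' Metric.closedBall 0 1) := fun z => by
    rw [image_image, image_image]
    refine image_congr fun x _ => ?_
    exact (T.toAffineMap.linearMap_vsub x z).symm
  have hvol : volume (T '' Metric.closedBall 0 1) = volume (T.linear '' Metric.closedBall 0 1) := by
    rw [← volume_image_sub _ (T 0), hsub]
    simp
  have hne : volume (T '' Metric.closedBall 0 1) ≠ 0 := by
    rw [hvol]
    intro h0
    have h := volume_image_mul_volume_polarSet_image T.linear (Metric.closedBall 0 1)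
      ((fun x => x - 0) '' Metric.closedBall 0 1)
    rw [h0, zero_mul, eq_comm, mul_eq_zero] at h
    have h1 := volume_closedBall_le_volume_polarSet (n := n) (z := 0) (by simp)
    rcases h with h | h
    · exact volume_unit_closedBall_ne_zero n h
    · rw [h] at h1
      exact volume_unit_closedBall_ne_zero n (le_zero_iff.1 h1)
  have hne' : volume (T '' Metric.closedBall 0 1) ≠ ⊤ := by
    refine (IsCompact.image (isCompact_closedBall 0 1) ?_).measure_ne_top
    exact T.toAffineMap.continuous_of_finiteDimensional
  rw [volumeProduct, ENNReal.mul_iInf_of_ne hne hne']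
  refine le_iInf fun ⟨z, hz⟩ => ?_
  obtain ⟨z, hzB, rfl⟩ := interior_subset hz
  simp only
  rw [hvol, hsub, volume_image_mul_volume_polarSet_image, sq]
  exact mul_le_mul' le_rfl (volume_closedBall_le_volume_polarSet (by simpa using hzB))

end Bodies

lemma isConvexBody_closedBall (n : ℕ) :
    IsConvexBody (Metric.closedBall (0 : EuclideanSpace ℝ (Fin n)) 1) :=
  ⟨convex_closedBall 0 1, isCompact_closedBall 0 1,
    ⟨0, mem_interior_iff_mem_nhds.2 (Metric.closedBall_mem_nhds 0 one_pos)⟩⟩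

lemma volumeProduct_le_of_mem_interior {n : ℕ} {K : Set (EuclideanSpace ℝ (Fin n))}
    {b : EuclideanSpace ℝ (Fin n)} (hb : b ∈ interior K) :
    volumeProduct K ≤ volume K * volume (polarSet ((fun x => x - b) '' K)) :=
  mul_le_mul' le_rfl (iInf_le (fun z : interior K =>
    volume (polarSet ((fun x => x - (z : EuclideanSpace ℝ (Fin n))) '' K))) ⟨b, hb⟩)

lemma IsConvexBody.volumeProduct_le {n : ℕ} {K : Set (EuclideanSpace ℝ (Fin n))}
    (hK : IsConvexBody K) :
    volumeProduct K ≤ volume (Metric.closedBall (0 : EuclideanSpace ℝ (Fin n)) 1) ^ 2 := by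
  obtain ⟨b, hb, h, -⟩ := hK.exists_volume_mul_volume_polarSet_le
  exact (volumeProduct_le_of_mem_interior hb).trans h

/-- Blaschke–Santaló–Petty inequality: `P(K) ≤ P(B₂ⁿ) = vol(B₂ⁿ)²`, with equality
iff `K` is an ellipsoid, i.e. an invertible affine image of the Euclidean unit ball. -/
theorem blaschke_santalo_petty (n : ℕ) (K : Set (EuclideanSpace ℝ (Fin n)))
    (hK : IsConvexBody K) :
    volumeProduct K ≤ (volume (Metric.closedBall (0 : EuclideanSpace ℝ (Fin n)) 1)) ^ 2 ∧
    volumeProduct (Metric.closedBall (0 : EuclideanSpace ℝ (Fin n)) 1) =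
      (volume (Metric.closedBall (0 : EuclideanSpace ℝ (Fin n)) 1)) ^ 2 ∧
    (volumeProduct K = (volume (Metric.closedBall (0 : EuclideanSpace ℝ (Fin n)) 1)) ^ 2 ↔
      ∃ T : EuclideanSpace ℝ (Fin n) ≃ᵃ[ℝ] EuclideanSpace ℝ (Fin n),
        K = T '' (Metric.closedBall (0 : EuclideanSpace ℝ (Fin n)) 1)) := by
  refine ⟨hK.volumeProduct_le,
    le_antisymm (isConvexBody_closedBall n).volumeProduct_le ?_, fun h => ?_, ?_⟩
  · simpa using le_volumeProduct_image_closedBall (AffineEquiv.refl ℝ (EuclideanSpace ℝ (Fin n)))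
  · obtain ⟨b, hb, hle, heq⟩ := hK.exists_volume_mul_volume_polarSet_le
    exact heq (hle.antisymm (h.ge.trans (volumeProduct_le_of_mem_interior hb)))
  · rintro ⟨T, rfl⟩
    exact hK.volumeProduct_le.antisymm (le_volumeProduct_image_closedBall T)
end
end

section
/- Let K be a convex body in ℝⁿ. Then the function z ↦ vol((K−z)*) is a strictly convex, positive, C^∞ function on the interior of K, it tends to +∞ as z approaches the boundary of K, and consequently it attains its minimum on int K at a unique point (the Santaló point s(K)). -/
open MeasureTheory Filter
open scoped InnerProductSpace Pointwise NNReal ENNReal Topology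

noncomputable section

/-- The support function `y ↦ sup {⟨x,y⟩ : x ∈ K}` of a set `K`. -/
def supportFn {n : ℕ} (K : Set (EuclideanSpace ℝ (Fin n))) (y : EuclideanSpace ℝ (Fin n)) : ℝ :=
  sSup ((fun x => ⟪x, y⟫_ℝ) '' K)

section LayerCake

variable {E : Type*} [NormedAddCommGroup E] [NormedSpace ℝ E] [FiniteDimensional ℝ E]
  [MeasurableSpace E] [BorelSpace E]

theorem lintegral_exp_neg_Ioi (c : ℝ) :
    ∫⁻ t in Set.Ioi c, ENNReal.ofReal (Real.exp (-t)) = ENNReal.ofReal (Real.exp (-c)) := by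
  rw [← ofReal_integral_eq_lintegral_ofReal (integrableOn_exp_neg_Ioi c)
    (ae_of_all _ fun t => (Real.exp_pos _).le), integral_exp_neg_Ioi]

theorem lintegral_exp_neg_mul_pow (n : ℕ) :
    ∫⁻ t in Set.Ioi (0 : ℝ), ENNReal.ofReal (Real.exp (-t)) * ENNReal.ofReal (t ^ n)
      = (n.factorial : ℝ≥0∞) := by
  have h : Set.EqOn (fun t : ℝ => Real.exp (-t) * t ^ ((n + 1 : ℝ) - 1))
      (fun t => Real.exp (-t) * t ^ n) (Set.Ioi 0) := fun t _ => by simp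
  have hint : IntegrableOn (fun t : ℝ => Real.exp (-t) * t ^ n) (Set.Ioi 0) :=
    (Real.GammaIntegral_convergent (s := n + 1) (by positivity)).congr_fun h measurableSet_Ioi
  have hval : ∫ t in Set.Ioi (0 : ℝ), Real.exp (-t) * t ^ n = n.factorial := by
    rw [← setIntegral_congr_fun measurableSet_Ioi h, ← Real.Gamma_eq_integral (by positivity),
      Real.Gamma_nat_eq_factorial]
  simp_rw [← ENNReal.ofReal_mul (Real.exp_pos _).le]
  rw [← ofReal_integral_eq_lintegral_ofReal hint, hval, ENNReal.ofReal_natCast]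
  filter_upwards [ae_restrict_mem measurableSet_Ioi] with t ht
  have : 0 < t := ht
  simp only [Pi.zero_apply]
  positivity

/-- The volume of a sublevel set of a positively homogeneous function, as a Laplace integral. -/
theorem lintegral_exp_neg_of_homogeneous (μ : Measure E) [μ.IsAddHaarMeasure] {g : E → ℝ}
    (hg : Measurable g) (hg0 : ∀ y, 0 ≤ g y) (hhom : ∀ t : ℝ, 0 < t → ∀ y, g (t • y) = t * g y) :
    ∫⁻ y, ENNReal.ofReal (Real.exp (-g y)) ∂μ
      = (Module.finrank ℝ E).factorial * μ {y | g y ≤ 1} := by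
  set n := Module.finrank ℝ E
  have hinner (y : E) : ENNReal.ofReal (Real.exp (-g y)) =
      ∫⁻ t in Set.Ioi (0 : ℝ),
        {p : E × ℝ | g p.1 ≤ p.2}.indicator (fun p => ENNReal.ofReal (Real.exp (-p.2))) (y, t) := by
    rw [← lintegral_exp_neg_Ioi]
    have : ∀ t : ℝ, {p : E × ℝ | g p.1 ≤ p.2}.indicator
        (fun p => ENNReal.ofReal (Real.exp (-p.2))) (y, t)
        = (Set.Ici (g y)).indicator (fun t => ENNReal.ofReal (Real.exp (-t))) t := fun t => by
      simp [Set.indicator_apply]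
    simp_rw [this]
    rw [lintegral_indicator measurableSet_Ici, Measure.restrict_restrict measurableSet_Ici]
    refine setLIntegral_congr ?_
    have h1 : (Set.Ici (g y) ∩ Set.Ioi 0 : Set ℝ) =ᵐ[volume]
        (Set.Ioi (g y) ∩ Set.Ioi 0 : Set ℝ) := Ioi_ae_eq_Ici.symm.inter (ae_eq_refl _)
    rw [Set.inter_eq_left.2 (Set.Ioi_subset_Ioi (hg0 y))] at h1
    exact h1.symm
  have hset : MeasurableSet {p : E × ℝ | g p.1 ≤ p.2} :=
    measurableSet_le (hg.comp measurable_fst) measurable_snd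
  simp_rw [hinner]
  rw [lintegral_lintegral_swap]
  · have : ∀ t ∈ Set.Ioi (0 : ℝ), ∫⁻ y, {p : E × ℝ | g p.1 ≤ p.2}.indicator
        (fun p => ENNReal.ofReal (Real.exp (-p.2))) (y, t) ∂μ
        = ENNReal.ofReal (Real.exp (-t)) * ENNReal.ofReal (t ^ n) * μ {y | g y ≤ 1} := by
      intro t ht
      have ht : 0 < t := ht
      have h1 : ∀ y : E, {p : E × ℝ | g p.1 ≤ p.2}.indicator
          (fun p => ENNReal.ofReal (Real.exp (-p.2))) (y, t)
          = {y | g y ≤ t}.indicator (fun _ => ENNReal.ofReal (Real.exp (-t))) y := fun y => by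
        simp [Set.indicator_apply]
      have h2 : {y | g y ≤ t} = t • {y | g y ≤ 1} := by
        ext y
        rw [Set.mem_smul_set_iff_inv_smul_mem₀ ht.ne']
        simp only [Set.mem_ofPred_eq, hhom _ (inv_pos.2 ht)]
        rw [inv_mul_le_iff₀ ht, mul_one]
      simp_rw [h1]
      rw [lintegral_indicator (measurableSet_le hg measurable_const), setLIntegral_const, h2,
        Measure.addHaar_smul, abs_of_pos (pow_pos ht _), mul_assoc]
    rw [setLIntegral_congr_fun measurableSet_Ioi this, lintegral_mul_const _ (by fun_prop),
      lintegral_exp_neg_mul_pow]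
  · exact (Measurable.indicator (by fun_prop) hset).aemeasurable

theorem integrable_exp_neg_mul_norm (μ : Measure E) [μ.IsAddHaarMeasure] {ε : ℝ} (hε : 0 < ε) :
    Integrable (fun y => Real.exp (-(ε * ‖y‖))) μ := by
  refine ⟨by fun_prop, ?_⟩
  rw [hasFiniteIntegral_iff_ofReal (ae_of_all _ fun _ => (Real.exp_pos _).le),
    lintegral_exp_neg_of_homogeneous μ (by fun_prop) (fun y => by positivity)
      (fun t ht y => by rw [norm_smul, Real.norm_of_nonneg ht.le]; ring)]
  have : {y : E | ε * ‖y‖ ≤ 1} = Metric.closedBall 0 ε⁻¹ := by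
    ext y
    rw [Set.mem_ofPred_eq, mem_closedBall_zero_iff, inv_eq_one_div, le_div_iff₀' hε]
  rw [this]
  exact ENNReal.mul_lt_top (by simp) measure_closedBall_lt_top

end LayerCake

theorem exp_add_mul_norm_mul_le {E : Type*} [NormedAddCommGroup E] {ε : ℝ} (hε : 0 < ε) (y : E)
    (a : ℝ) {c : ℝ} (hc : 0 ≤ c) :
    Real.exp (a + ε / 2 * ‖y‖) * (‖y‖ * c) ≤ 2 / ε * (Real.exp (a + ε * ‖y‖) * c) := by
  have h : ‖y‖ ≤ 2 / ε * Real.exp (ε / 2 * ‖y‖) := by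
    have h := Real.add_one_le_exp (ε / 2 * ‖y‖)
    calc ‖y‖ = 2 / ε * (ε / 2 * ‖y‖) := by field_simp
      _ ≤ _ := by gcongr; linarith
  calc Real.exp (a + ε / 2 * ‖y‖) * (‖y‖ * c)
      ≤ Real.exp (a + ε / 2 * ‖y‖) * ((2 / ε * Real.exp (ε / 2 * ‖y‖)) * c) := by gcongr
    _ = 2 / ε * (Real.exp (a + ε * ‖y‖) * c) := by
        rw [show a + ε * ‖y‖ = (a + ε / 2 * ‖y‖) + ε / 2 * ‖y‖ by ring,
          Real.exp_add (a + ε / 2 * ‖y‖)]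
        ring

section Laplace

variable {E : Type} [NormedAddCommGroup E] [InnerProductSpace ℝ E] [FiniteDimensional ℝ E]
  [MeasurableSpace E] [BorelSpace E] {μ : Measure E} {U : Set E}

theorem hasFDerivAt_integral_exp_inner_smul {V : Type} [NormedAddCommGroup V] [NormedSpace ℝ V]
    {G : E → V} (hG : AEStronglyMeasurable G μ) {z : E} {ε : ℝ} (hε : 0 < ε)
    (hint : Integrable (fun y => Real.exp (⟪z, y⟫_ℝ + ε * ‖y‖) * ‖G y‖) μ) :
    HasFDerivAt (fun z => ∫ y, Real.exp ⟪z, y⟫_ℝ • G y ∂μ)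
      (∫ y, Real.exp ⟪z, y⟫_ℝ • (innerSL ℝ y).smulRight (G y) ∂μ) z := by
  have hmeas (z : E) : AEStronglyMeasurable (fun y => Real.exp ⟪z, y⟫_ℝ • G y) μ :=
    AEStronglyMeasurable.smul (by fun_prop) hG
  refine hasFDerivAt_integral_of_dominated_of_fderiv_le (𝕜 := ℝ)
    (F := fun z y => Real.exp ⟪z, y⟫_ℝ • G y)
    (F' := fun z y => Real.exp ⟪z, y⟫_ℝ • (innerSL ℝ y).smulRight (G y))
    (bound := fun y => (2 / ε) * (Real.exp (⟪z, y⟫_ℝ + ε * ‖y‖) * ‖G y‖))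
    (Metric.ball_mem_nhds z (half_pos hε)) (Eventually.of_forall hmeas) ?_ ?_ ?_
    (hint.const_mul _) ?_
  · refine hint.mono' (hmeas z) (ae_of_all _ fun y => ?_)
    rw [norm_smul, Real.norm_of_nonneg (Real.exp_pos _).le]
    gcongr
    have : 0 ≤ ε * ‖y‖ := by positivity
    linarith
  · refine AEStronglyMeasurable.smul (f := fun y => Real.exp ⟪z, y⟫_ℝ) (by fun_prop) ?_
    exact ((ContinuousLinearMap.smulRightL ℝ E V).continuous₂).comp_aestronglyMeasurable
      ((innerSL ℝ).continuous.aestronglyMeasurable.prodMk hG)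
  · refine ae_of_all _ fun y w hw => ?_
    rw [norm_smul, Real.norm_of_nonneg (Real.exp_pos _).le, ContinuousLinearMap.norm_smulRight_apply,
      innerSL_apply_norm]
    have h1 : ⟪w, y⟫_ℝ ≤ ⟪z, y⟫_ℝ + ε / 2 * ‖y‖ := by
      have h := real_inner_le_norm (w - z) y
      rw [inner_sub_left] at h
      have : ‖w - z‖ * ‖y‖ ≤ ε / 2 * ‖y‖ := by
        gcongr
        exact (mem_ball_iff_norm.1 hw).le
      linarith
    calc Real.exp ⟪w, y⟫_ℝ * (‖y‖ * ‖G y‖)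
        ≤ Real.exp (⟪z, y⟫_ℝ + ε / 2 * ‖y‖) * (‖y‖ * ‖G y‖) := by gcongr
      _ ≤ _ := exp_add_mul_norm_mul_le hε y _ (norm_nonneg _)
  · refine ae_of_all _ fun y w _ => ?_
    have h : HasFDerivAt (fun w : E => ⟪w, y⟫_ℝ) (innerSL ℝ y) w := by
      refine (innerSL ℝ y).hasFDerivAt.congr_of_eventuallyEq (Eventually.of_forall fun v => ?_)
      exact real_inner_comm _ _
    convert h.exp.smul_const (G y) using 1
    ext v
    simp [mul_smul]

theorem integrable_exp_inner_mul_norm_smulRight {V : Type} [NormedAddCommGroup V]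
    [NormedSpace ℝ V] {G : E → V} (hG : AEStronglyMeasurable G μ) {z : E} {ε : ℝ} (hε : 0 < ε)
    (hint : Integrable (fun y => Real.exp (⟪z, y⟫_ℝ + ε * ‖y‖) * ‖G y‖) μ) :
    Integrable (fun y => Real.exp (⟪z, y⟫_ℝ + ε / 2 * ‖y‖) * ‖(innerSL ℝ y).smulRight (G y)‖) μ := by
  refine (hint.const_mul (2 / ε)).mono' ?_ (ae_of_all _ fun y => ?_)
  · refine AEStronglyMeasurable.mul (by fun_prop) ?_
    simp only [ContinuousLinearMap.norm_smulRight_apply, innerSL_apply_norm]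
    exact (continuous_norm.aestronglyMeasurable).mul hG.norm
  · rw [Real.norm_of_nonneg (by positivity), ContinuousLinearMap.norm_smulRight_apply,
      innerSL_apply_norm]
    exact exp_add_mul_norm_mul_le hε y _ (norm_nonneg _)

/-- Laplace transforms are smooth on open subsets of their domain of convergence. -/
theorem contDiffOn_integral_exp_inner_smul (hU : IsOpen U) (k : ℕ) :
    ∀ {V : Type} [NormedAddCommGroup V] [NormedSpace ℝ V] {G : E → V},
      AEStronglyMeasurable G μ →
      (∀ z ∈ U, ∃ ε > 0, Integrable (fun y => Real.exp (⟪z, y⟫_ℝ + ε * ‖y‖) * ‖G y‖) μ) →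
      ContDiffOn ℝ k (fun z => ∫ y, Real.exp ⟪z, y⟫_ℝ • G y ∂μ) U := by
  induction k with
  | zero =>
    intro V _ _ G hG h
    rw [Nat.cast_zero, contDiffOn_zero]
    intro z hz
    obtain ⟨ε, hε, hint⟩ := h z hz
    exact (hasFDerivAt_integral_exp_inner_smul hG hε hint).continuousAt.continuousWithinAt
  | succ k ih =>
    intro V _ _ G hG h
    rw [Nat.cast_add, Nat.cast_one,
      contDiffOn_succ_iff_hasFDerivWithinAt_of_uniqueDiffOn hU.uniqueDiffOn]
    refine ⟨by simp, fun z => ∫ y, Real.exp ⟪z, y⟫_ℝ • (innerSL ℝ y).smulRight (G y) ∂μ,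
      ih ?_ fun z hz => ?_, fun z hz => ?_⟩
    · exact ((ContinuousLinearMap.smulRightL ℝ E V).continuous₂).comp_aestronglyMeasurable
        ((innerSL ℝ).continuous.aestronglyMeasurable.prodMk hG)
    · obtain ⟨ε, hε, hint⟩ := h z hz
      exact ⟨ε / 2, half_pos hε, integrable_exp_inner_mul_norm_smulRight hG hε hint⟩
    · obtain ⟨ε, hε, hint⟩ := h z hz
      exact (hasFDerivAt_integral_exp_inner_smul hG hε hint).hasFDerivWithinAt

end Laplace

section SupportFunction

variable {n : ℕ} {K : Set (EuclideanSpace ℝ (Fin n))}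

theorem inner_le_supportFn (hK : IsCompact K) {x : EuclideanSpace ℝ (Fin n)} (hx : x ∈ K)
    (y : EuclideanSpace ℝ (Fin n)) : ⟪x, y⟫_ℝ ≤ supportFn K y :=
  le_csSup (hK.image (by fun_prop)).bddAbove (Set.mem_image_of_mem _ hx)

theorem continuous_supportFn (hK : IsCompact K) : Continuous (supportFn K) :=
  hK.continuous_sSup (f := fun y x => ⟪x, y⟫_ℝ) (by fun_prop)

theorem supportFn_smul (K : Set (EuclideanSpace ℝ (Fin n))) {t : ℝ} (ht : 0 ≤ t)
    (y : EuclideanSpace ℝ (Fin n)) : supportFn K (t • y) = t * supportFn K y := by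
  rw [supportFn, supportFn, ← smul_eq_mul, ← Real.sSup_smul_of_nonneg ht, ← Set.image_smul,
    Set.image_image]
  simp only [inner_smul_right, smul_eq_mul]

theorem polarSet_image_sub (hK : IsCompact K) (hne : K.Nonempty)
    (z : EuclideanSpace ℝ (Fin n)) :
    polarSet ((fun x => x - z) '' K) = {y | supportFn K y - ⟪z, y⟫_ℝ ≤ 1} := by
  ext y
  simp only [polarSet, Set.mem_ofPred_eq, Set.forall_mem_image, inner_sub_left, sub_le_iff_le_add]
  refine ⟨fun h => csSup_le (hne.image _) ?_, fun h x hx => (inner_le_supportFn hK hx y).trans h⟩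
  rintro _ ⟨x, hx, rfl⟩
  exact h hx

/-- The volume of the polar of `K - z`, as the Laplace transform at `z` of `exp (-h_K)`. -/
theorem lintegral_exp_inner_sub_supportFn (hK : IsCompact K)
    {z : EuclideanSpace ℝ (Fin n)} (hz : z ∈ K) :
    ∫⁻ y, ENNReal.ofReal (Real.exp (⟪z, y⟫_ℝ - supportFn K y))
      = n.factorial * volume (polarSet ((fun x => x - z) '' K)) := by
  have hc := continuous_supportFn hK
  have h := lintegral_exp_neg_of_homogeneous (volume : Measure (EuclideanSpace ℝ (Fin n)))
    (g := fun y => supportFn K y - ⟪z, y⟫_ℝ) (by fun_prop)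
    (fun y => sub_nonneg.2 (inner_le_supportFn hK hz y))
    (fun t ht y => by rw [supportFn_smul K ht.le, inner_smul_right]; ring)
  simpa only [neg_sub, finrank_euclideanSpace_fin, polarSet_image_sub hK ⟨z, hz⟩] using h

theorem exists_mul_norm_le_supportFn_sub (hK : IsCompact K) {z : EuclideanSpace ℝ (Fin n)}
    (hz : z ∈ interior K) :
    ∃ r > 0, ∀ y, ⟪z, y⟫_ℝ + r * ‖y‖ ≤ supportFn K y := by
  obtain ⟨r, hr, hball⟩ := Metric.nhds_basis_closedBall.mem_iff.1 (mem_interior_iff_mem_nhds.1 hz)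
  refine ⟨r, hr, fun y => ?_⟩
  have hmem : z + (r / ‖y‖) • y ∈ K := hball <| by
    rw [mem_closedBall_iff_norm, add_sub_cancel_left, norm_smul, norm_div, norm_norm,
      Real.norm_of_nonneg hr.le]
    rcases eq_or_ne ‖y‖ 0 with h | h
    · simp [h, hr.le]
    · rw [div_mul_cancel₀ _ h]
  convert inner_le_supportFn hK hmem y using 1
  rw [inner_add_left, real_inner_smul_left, real_inner_self_eq_norm_sq]
  rcases eq_or_ne ‖y‖ 0 with h | h
  · simp [h]
  · field_simp

theorem exists_integrable_exp_inner_add_mul_norm (hK : IsCompact K)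
    {z : EuclideanSpace ℝ (Fin n)} (hz : z ∈ interior K) :
    ∃ ε > 0, Integrable fun y : EuclideanSpace ℝ (Fin n) =>
      Real.exp (⟪z, y⟫_ℝ + ε * ‖y‖) * ‖Real.exp (-supportFn K y)‖ := by
  obtain ⟨r, hr, h⟩ := exists_mul_norm_le_supportFn_sub hK hz
  have hc := continuous_supportFn hK
  refine ⟨r / 2, half_pos hr, (integrable_exp_neg_mul_norm volume (half_pos hr)).mono'
    (by fun_prop) (ae_of_all _ fun y => ?_)⟩
  rw [Real.norm_of_nonneg (by positivity), Real.norm_of_nonneg (by positivity), ← Real.exp_add,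
    Real.exp_le_exp]
  linarith [h y]

theorem integrable_exp_inner_mul_exp_neg_supportFn (hK : IsCompact K)
    {z : EuclideanSpace ℝ (Fin n)} (hz : z ∈ interior K) :
    Integrable fun y => Real.exp ⟪z, y⟫_ℝ * Real.exp (-supportFn K y) := by
  obtain ⟨ε, hε, h⟩ := exists_integrable_exp_inner_add_mul_norm hK hz
  have hc := continuous_supportFn hK
  refine h.mono' (by fun_prop) (ae_of_all _ fun y => ?_)
  rw [Real.norm_of_nonneg (by positivity), Real.norm_of_nonneg (Real.exp_pos _).le]
  gcongr
  have : 0 ≤ ε * ‖y‖ := by positivity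
  linarith

theorem volume_polarSet_image_sub_ne_top (hK : IsCompact K)
    {z : EuclideanSpace ℝ (Fin n)} (hz : z ∈ interior K) :
    volume (polarSet ((fun x => x - z) '' K)) ≠ ⊤ := by
  have h := (integrable_exp_inner_mul_exp_neg_supportFn hK hz).lintegral_lt_top
  simp only [← Real.exp_add, ← sub_eq_add_neg] at h
  rw [lintegral_exp_inner_sub_supportFn hK (interior_subset hz)] at h
  exact (ENNReal.lt_top_of_mul_ne_top_right h.ne (by simp [n.factorial_ne_zero])).ne

theorem toReal_volume_polarSet_image_sub (hK : IsCompact K)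
    {z : EuclideanSpace ℝ (Fin n)} (hz : z ∈ interior K) :
    (volume (polarSet ((fun x => x - z) '' K))).toReal
      = (n.factorial : ℝ)⁻¹ * ∫ y, Real.exp ⟪z, y⟫_ℝ • Real.exp (-supportFn K y) := by
  have hc := continuous_supportFn hK
  rw [eq_inv_mul_iff_mul_eq₀ (by exact_mod_cast n.factorial_ne_zero),
    integral_eq_lintegral_of_nonneg_ae (ae_of_all _ fun y => by
      simp only [Pi.zero_apply, smul_eq_mul]; positivity) (by fun_prop)]
  simp only [smul_eq_mul, ← Real.exp_add, ← sub_eq_add_neg]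
  rw [lintegral_exp_inner_sub_supportFn hK (interior_subset hz), ENNReal.toReal_mul,
    ENNReal.toReal_natCast]

theorem strictConvexOn_integral_exp_inner (hK : IsConvexBody K) :
    StrictConvexOn ℝ (interior K)
      fun z => ∫ y, Real.exp ⟪z, y⟫_ℝ • Real.exp (-supportFn K y) := by
  have hint := fun z hz => integrable_exp_inner_mul_exp_neg_supportFn hK.isCompact (z := z) hz
  refine ⟨hK.convex.interior, fun x hx z hz hxz a b ha hb hab => ?_⟩
  have hw : a • x + b • z ∈ interior K := hK.convex.interior hx hz ha.le hb.le hab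
  have hsum : Integrable fun y => a * (Real.exp ⟪x, y⟫_ℝ * Real.exp (-supportFn K y))
      + b * (Real.exp ⟪z, y⟫_ℝ * Real.exp (-supportFn K y)) :=
    ((hint x hx).const_mul a).add ((hint z hz).const_mul b)
  simp only [smul_eq_mul]
  rw [← integral_const_mul, ← integral_const_mul,
    ← integral_add ((hint x hx).const_mul a) ((hint z hz).const_mul b), ← sub_pos,
    ← integral_sub hsum (hint _ hw)]
  have hpt (y : EuclideanSpace ℝ (Fin n)) :
      a * (Real.exp ⟪x, y⟫_ℝ * Real.exp (-supportFn K y))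
        + b * (Real.exp ⟪z, y⟫_ℝ * Real.exp (-supportFn K y))
        - Real.exp ⟪a • x + b • z, y⟫_ℝ * Real.exp (-supportFn K y)
      = (a * Real.exp ⟪x, y⟫_ℝ + b * Real.exp ⟪z, y⟫_ℝ
          - Real.exp (a * ⟪x, y⟫_ℝ + b * ⟪z, y⟫_ℝ)) * Real.exp (-supportFn K y) := by
    rw [inner_add_left, real_inner_smul_left, real_inner_smul_left]
    ring
  rw [integral_pos_iff_support_of_nonneg]
  · have hopen : IsOpen {y : EuclideanSpace ℝ (Fin n) | ⟪x, y⟫_ℝ ≠ ⟪z, y⟫_ℝ} :=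
      isOpen_ne_fun (by fun_prop) (by fun_prop)
    refine (hopen.measure_pos volume ⟨x - z, ?_⟩).trans_le (measure_mono fun y hy => ?_)
    · rw [Set.mem_ofPred_eq, ← sub_ne_zero, ← inner_sub_left]
      exact inner_self_ne_zero.2 (sub_ne_zero.2 hxz)
    · have h := strictConvexOn_exp.2 (Set.mem_univ _) (Set.mem_univ _) hy ha hb hab
      simp only [smul_eq_mul] at h
      rw [Function.mem_support]
      rw [hpt]
      exact (mul_pos (sub_pos.2 h) (Real.exp_pos _)).ne'
  · intro y
    have h := convexOn_exp.2 (Set.mem_univ ⟪x, y⟫_ℝ) (Set.mem_univ ⟪z, y⟫_ℝ) ha.le hb.le hab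
    simp only [smul_eq_mul] at h
    simp only [Pi.zero_apply]
    rw [hpt]
    exact mul_nonneg (sub_nonneg.2 h) (Real.exp_pos _).le
  · exact hsum.sub (hint _ hw)

end SupportFunction

section Boundary

variable {n : ℕ} {K : Set (EuclideanSpace ℝ (Fin n))}

/-- A set containing a half-line of balls of a fixed radius has infinite measure. -/
theorem measure_eq_top_of_forall_ball_subset {E : Type*} [NormedAddCommGroup E] [NormedSpace ℝ E]
    [FiniteDimensional ℝ E] [MeasurableSpace E] [BorelSpace E] (μ : Measure E)
    [μ.IsAddHaarMeasure] {A : Set E} {u : E} (hu : u ≠ 0) {r : ℝ} (hr : 0 < r)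
    (h : ∀ t : ℝ, 0 ≤ t → Metric.ball (t • u) r ⊆ A) : μ A = ⊤ := by
  set s := min r (‖u‖ / 2)
  have hs : 0 < s := lt_min hr (half_pos (norm_pos_iff.2 hu))
  have hdisj : Pairwise (Function.onFun Disjoint fun k : ℕ => Metric.ball ((k : ℝ) • u) s) := by
    intro k m hkm
    refine Metric.ball_disjoint_ball ?_
    rw [dist_eq_norm, ← sub_smul, norm_smul]
    have h1 : (1 : ℝ) ≤ ‖(k : ℝ) - m‖ := by
      have h := Int.one_le_abs (sub_ne_zero.2 (Nat.cast_injective.ne hkm : (k : ℤ) ≠ m))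
      rw [Real.norm_eq_abs]
      exact_mod_cast h
    have h2 : s ≤ ‖u‖ / 2 := min_le_right _ _
    nlinarith [norm_nonneg u]
  have hsub : ⋃ k : ℕ, Metric.ball ((k : ℝ) • u) s ⊆ A := Set.iUnion_subset fun k =>
    (Metric.ball_subset_ball (min_le_left _ _)).trans (h k k.cast_nonneg)
  refine top_le_iff.1 (le_trans ?_ (measure_mono hsub))
  rw [measure_iUnion hdisj fun _ => measurableSet_ball]
  simp_rw [Measure.addHaar_ball_center μ _ s]
  rw [ENNReal.tsum_const_eq_top_of_ne_zero (Metric.measure_ball_pos μ 0 hs).ne']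

theorem volume_polarSet_image_sub_eq_top (hK : IsConvexBody K)
    {b : EuclideanSpace ℝ (Fin n)} (hb : b ∈ frontier K) :
    volume (polarSet ((fun x => x - b) '' K)) = ⊤ := by
  obtain ⟨φ, hφ⟩ := geometric_hahn_banach_open_point hK.convex.interior isOpen_interior hb.2
  set u := (InnerProductSpace.toDual ℝ (EuclideanSpace ℝ (Fin n))).symm φ
  have hu (x : EuclideanSpace ℝ (Fin n)) : ⟪x, u⟫_ℝ = φ x := by
    rw [real_inner_comm]
    exact InnerProductSpace.toDual_symm_apply
  obtain ⟨c, hc⟩ := hK.nonempty_interior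
  have hu0 : u ≠ 0 := by
    intro h
    have := hφ c hc
    rw [← hu, ← hu, h] at this
    simp at this
  have hle : ∀ x ∈ K, ⟪x - b, u⟫_ℝ ≤ 0 := by
    intro x hx
    rw [hu, map_sub, sub_nonpos]
    have hx' : x ∈ closure (interior K) := by
      rw [hK.convex.closure_interior_eq_closure_of_nonempty_interior hK.nonempty_interior]
      exact subset_closure hx
    exact closure_minimal (fun a ha => (hφ a ha).le)
      (isClosed_le φ.continuous continuous_const) hx'
  obtain ⟨D, hD, hDK⟩ := hK.isCompact.isBounded.exists_pos_norm_le
  have hpos : 0 < D + ‖b‖ := by positivity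
  refine measure_eq_top_of_forall_ball_subset volume hu0 (inv_pos.2 hpos) fun t ht y hy => ?_
  rintro _ ⟨x, hx, rfl⟩
  have h1 : ⟪x - b, y⟫_ℝ = ⟪x - b, y - t • u⟫_ℝ + t * ⟪x - b, u⟫_ℝ := by
    rw [← real_inner_smul_right, ← inner_add_right, sub_add_cancel]
  have h2 : ⟪x - b, y - t • u⟫_ℝ ≤ 1 := by
    refine (real_inner_le_norm _ _).trans ?_
    calc ‖x - b‖ * ‖y - t • u‖ ≤ (D + ‖b‖) * (D + ‖b‖)⁻¹ := by
          gcongr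
          · exact (norm_sub_le _ _).trans (by gcongr; exact hDK x hx)
          · exact (mem_ball_iff_norm.1 hy).le
      _ = 1 := mul_inv_cancel₀ hpos.ne'
  have h3 := mul_nonpos_of_nonneg_of_nonpos ht (hle x hx)
  simp only
  linarith

theorem smul_polarSet_inter_closedBall_subset {b z : EuclideanSpace ℝ (Fin n)} {R : ℝ}
    (hzb : ‖z - b‖ * R ≤ 1) :
    (2⁻¹ : ℝ) • (polarSet ((fun x => x - b) '' K) ∩ Metric.closedBall 0 R)
      ⊆ polarSet ((fun x => x - z) '' K) := by
  rintro _ ⟨y, ⟨hy, hyR⟩, rfl⟩ _ ⟨x, hx, rfl⟩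
  have h1 : ⟪x - b, y⟫_ℝ ≤ 1 := hy _ (Set.mem_image_of_mem _ hx)
  have h2 : ⟪b - z, y⟫_ℝ ≤ 1 := by
    refine (real_inner_le_norm _ _).trans (le_trans ?_ hzb)
    rw [norm_sub_rev]
    gcongr
    exact mem_closedBall_zero_iff.1 hyR
  have h3 : ⟪x - z, y⟫_ℝ = ⟪x - b, y⟫_ℝ + ⟪b - z, y⟫_ℝ := by
    rw [← inner_add_left, sub_add_sub_cancel]
  simp only [inner_smul_right]
  linarith

theorem tendsto_toReal_volume_polarSet_image_sub (hK : IsConvexBody K)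
    {b : EuclideanSpace ℝ (Fin n)} (hb : b ∈ frontier K) :
    Tendsto (fun z => (volume (polarSet ((fun x => x - z) '' K))).toReal)
      (𝓝[interior K] b) atTop := by
  set A := polarSet ((fun x => x - b) '' K)
  have htend : Tendsto (fun k : ℕ => volume (A ∩ Metric.closedBall 0 (k : ℝ))) atTop (𝓝 ⊤) := by
    have h := tendsto_measure_iUnion_atTop (μ := volume)
      (s := fun k : ℕ => A ∩ Metric.closedBall 0 (k : ℝ)) fun i j hij =>
        Set.inter_subset_inter_right _ (Metric.closedBall_subset_closedBall (by exact_mod_cast hij))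
    rwa [← Set.inter_iUnion, Metric.iUnion_closedBall_nat, Set.inter_univ,
      volume_polarSet_image_sub_eq_top hK hb] at h
  refine tendsto_atTop.2 fun M => ?_
  obtain ⟨k, hk⟩ := (htend.eventually_const_lt
    (ENNReal.ofReal_lt_top (r := 2 ^ n * M))).exists
  have hnear : ∀ᶠ z in 𝓝[interior K] b, ‖z - b‖ * k < 1 := by
    refine Filter.Eventually.filter_mono nhdsWithin_le_nhds ?_
    have hc : Continuous fun z : EuclideanSpace ℝ (Fin n) => ‖z - b‖ * (k : ℝ) := by fun_prop
    exact hc.continuousAt.eventually_lt_const (by simp)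
  filter_upwards [hnear, self_mem_nhdsWithin] with z hz hzK
  have h := measure_mono (μ := volume) (smul_polarSet_inter_closedBall_subset (K := K) hz.le)
  rw [Measure.addHaar_smul, finrank_euclideanSpace_fin, abs_of_pos (by positivity)] at h
  have hfin := volume_polarSet_image_sub_ne_top hK.isCompact hzK
  rw [← ENNReal.ofReal_le_iff_le_toReal hfin]
  refine le_trans ?_ h
  calc ENNReal.ofReal M = ENNReal.ofReal ((2⁻¹ : ℝ) ^ n) * ENNReal.ofReal (2 ^ n * M) := by
        rw [← ENNReal.ofReal_mul (by positivity), ← mul_assoc, ← mul_pow]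
        simp
    _ ≤ _ := by gcongr

end Boundary

/-- A continuous function on the interior of a compact set that blows up at the frontier
attains its minimum. -/
theorem exists_isMinOn_interior_of_tendsto_atTop {X : Type*} [TopologicalSpace X] [T2Space X]
    {K : Set X} (hK : IsCompact K) (hne : (interior K).Nonempty) {f : X → ℝ}
    (hf : ContinuousOn f (interior K))
    (hb : ∀ b ∈ frontier K, Tendsto f (𝓝[interior K] b) atTop) :
    ∃ s ∈ interior K, IsMinOn f (interior K) s := by
  obtain ⟨c, hc⟩ := hne
  set S := {z ∈ interior K | f z ≤ f c}
  have hclosed : IsClosed S := by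
    refine isClosed_of_closure_subset fun z hz => ?_
    have hne : (𝓝[S] z).NeBot := mem_closure_iff_nhdsWithin_neBot.1 hz
    have hle : 𝓝[S] z ≤ 𝓝[interior K] z := nhdsWithin_mono _ fun _ h => h.1
    have hzK : z ∈ K := closure_minimal (fun _ h => interior_subset h.1) hK.isClosed hz
    have hev : ∀ᶠ w in 𝓝[S] z, f w ≤ f c :=
      eventually_nhdsWithin_of_forall fun w hw => hw.2
    by_cases hzi : z ∈ interior K
    · exact ⟨hzi, le_of_tendsto ((hf z hzi).tendsto.mono_left hle) hev⟩
    · have h := ((hb z ⟨subset_closure hzK, hzi⟩).mono_left hle).eventually_gt_atTop (f c)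
      obtain ⟨w, hw1, hw2⟩ := (h.and hev).exists
      exact absurd hw2 (not_le.2 hw1)
  obtain ⟨s, hs, hmin⟩ := (hK.of_isClosed_subset hclosed fun _ h => interior_subset h.1)
    |>.exists_isMinOn ⟨c, hc, le_rfl⟩ (hf.mono fun _ h => h.1)
  refine ⟨s, hs.1, fun z hz => ?_⟩
  rcases le_total (f z) (f c) with h | h
  · exact hmin ⟨hz, h⟩
  · exact hs.2.trans h

/-- For a convex body `K`, the function `z ↦ vol((K - z)*)` is strictly convex, positive and
`C^∞` on the interior of `K`, tends to `+∞` as `z` approaches the boundary of `K`, and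
attains its minimum on `int K` at a unique point (the Santaló point). -/
theorem santalo_point (n : ℕ) (K : Set (EuclideanSpace ℝ (Fin n))) (hK : IsConvexBody K)
    (f : EuclideanSpace ℝ (Fin n) → ℝ)
    (hf : ∀ z, f z = (volume (polarSet ((fun x => x - z) '' K))).toReal) :
    StrictConvexOn ℝ (interior K) f ∧
    (∀ z ∈ interior K, 0 < f z) ∧
    ContDiffOn ℝ (⊤ : ℕ∞) f (interior K) ∧
    (∀ b ∈ frontier K, Tendsto f (nhdsWithin b (interior K)) atTop) ∧
    (∃! s, s ∈ interior K ∧ ∀ z ∈ interior K, f s ≤ f z) := by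
  obtain rfl : f = fun z => (volume (polarSet ((fun x => x - z) '' K))).toReal := funext hf
  have heq : Set.EqOn (fun z => (volume (polarSet ((fun x => x - z) '' K))).toReal)
      (fun z => (n.factorial : ℝ)⁻¹ * ∫ y, Real.exp ⟪z, y⟫_ℝ • Real.exp (-supportFn K y))
      (interior K) := fun z hz => toReal_volume_polarSet_image_sub hK.isCompact hz
  have hpos : (0 : ℝ) < (n.factorial : ℝ)⁻¹ := by positivity
  have hcont := continuous_supportFn hK.isCompact
  have hconv : StrictConvexOn ℝ (interior K)
      fun z => (volume (polarSet ((fun x => x - z) '' K))).toReal := by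
    refine StrictConvexOn.congr ?_ heq.symm
    obtain ⟨hC, h⟩ := strictConvexOn_integral_exp_inner hK
    refine ⟨hC, fun x hx z hz hxz a b ha hb hab => ?_⟩
    have := mul_lt_mul_of_pos_left (h hx hz hxz ha hb hab) hpos
    simp only [smul_eq_mul] at this ⊢
    linarith
  have hsmooth : ContDiffOn ℝ (⊤ : ℕ∞)
      (fun z => (volume (polarSet ((fun x => x - z) '' K))).toReal) (interior K) := by
    refine ContDiffOn.congr (contDiffOn_infty.2 fun k => ?_) heq
    exact contDiffOn_const.mul (contDiffOn_integral_exp_inner_smul isOpen_interior k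
      (by fun_prop) fun z hz => exists_integrable_exp_inner_add_mul_norm hK.isCompact hz)
  have hblow := fun b hb => tendsto_toReal_volume_polarSet_image_sub hK (b := b) hb
  refine ⟨hconv, fun z hz => ?_, hsmooth, hblow, ?_⟩
  · have hint := integrable_exp_inner_mul_exp_neg_supportFn hK.isCompact hz
    simp only [← Real.exp_add] at hint
    rw [heq hz]
    simp only [smul_eq_mul, ← Real.exp_add]
    exact mul_pos hpos (integral_exp_pos hint)
  · obtain ⟨s, hs, hmin⟩ := exists_isMinOn_interior_of_tendsto_atTop hK.isCompact
      hK.nonempty_interior hsmooth.continuousOn hblow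
    exact ⟨s, ⟨hs, fun z hz => hmin hz⟩, fun t ht =>
      hconv.eq_of_isMinOn (fun z hz => ht.2 z hz) hmin ht.1 hs⟩
end
end
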